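/- Let x be a positive integer and let n, m, r be nonnegative integers such that n ≤ 2m+4 whenever m ≠ 0. Then all solutions (n, m, r, x) of the Diophantine equation F_n^x − F_m^x = L_r are: (1,0,1,x) and (2,0,1,x) for arbitrary x ≥ 1; the sporadic solutions (3,0,3,2), (3,0,0,1), (4,0,2,1), (3,1,1,1), (3,2,1,1), (3,1,2,2), (3,2,2,2), (3,1,4,3), (3,2,4,3), (4,1,0,1), (4,2,0,1), (5,4,0,1), (4,3,1,1), (5,2,3,1), (6,5,2,1), (6,1,4,1), (5,3,2,1); and the infinite family (k+1, k−3, k−1, 1) for every integer k ≥ 4. -/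

import Mathlib

/-- The Lucas sequence: `L 0 = 2`, `L 1 = 1`, `L (n+2) = L (n+1) + L n`. -/
def lucas : ℕ → ℕ
  | 0 => 2
  | 1 => 1
  | n + 2 => lucas (n + 1) + lucas n

section

open Real goldenRatio Polynomial
open scoped goldenRatio

/-- Integer polynomials take values in `ℤ[φ]` at the golden ratio, compatibly with conjugation. -/
theorem exists_eval_goldenRatio (P : ℤ[X]) : ∃ u v : ℤ,
    aeval φ P = u + v * φ ∧ aeval ψ P = u + v * ψ := by
  induction P using Polynomial.induction_on' with
  | add p q hp hq =>
    obtain ⟨u, v, h1, h2⟩ := hp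
    obtain ⟨u', v', h3, h4⟩ := hq
    refine ⟨u + u', v + v', ?_, ?_⟩
    · rw [map_add, h1, h3]; push_cast; ring
    · rw [map_add, h2, h4]; push_cast; ring
  | monomial n a =>
    cases n with
    | zero => exact ⟨a, 0, by simp, by simp⟩
    | succ n =>
      refine ⟨a * Nat.fib n, a * Nat.fib (n + 1), ?_, ?_⟩
      · rw [aeval_monomial, ← goldenRatio_mul_fib_succ_add_fib]; simp; ring
      · rw [aeval_monomial, ← goldenConj_mul_fib_succ_add_fib]; simp; ring

theorem one_le_abs_eval_mul_abs_eval (P : ℤ[X]) (hP : aeval φ P ≠ 0) :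
    1 ≤ |aeval φ P| * |aeval ψ P| := by
  obtain ⟨u, v, h1, h2⟩ := exists_eval_goldenRatio P
  have hne : aeval ψ P ≠ 0 := by
    intro h0
    rw [h2] at h0
    have hv : v = 0 := by
      by_contra hv
      have := (goldenConj_irrational.intCast_mul hv).intCast_add u
      exact this.ne_zero h0
    subst hv
    apply hP
    rw [h1]
    simpa using h0
  have hprod : aeval φ P * aeval ψ P = ((u ^ 2 + u * v - v ^ 2 : ℤ) : ℝ) := by
    rw [h1, h2]
    push_cast
    linear_combination (u : ℝ) * v * goldenRatio_add_goldenConj +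
      (v : ℝ) ^ 2 * goldenRatio_mul_goldenConj
  rw [← abs_mul, hprod]
  have : (u ^ 2 + u * v - v ^ 2 : ℤ) ≠ 0 := by
    intro h
    rw [h] at hprod
    simp at hprod
    tauto
  exact_mod_cast Int.one_le_abs this

open Finset in
theorem Finset.card_mul_card_sub_one_le_two_mul_sum (s : Finset ℕ) :
    s.card * (s.card - 1) ≤ 2 * ∑ i ∈ s, i := by
  induction s using Finset.induction_on_max with
  | empty => simp
  | insert a s ha ih =>
    have hns : a ∉ s := fun h => lt_irrefl _ (ha a h)
    rw [card_insert_of_notMem hns, sum_insert hns]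
    have : s.card ≤ a := by
      have : s ⊆ range a := fun x hx => mem_range.2 (ha x hx)
      simpa using card_le_card this
    rcases Nat.eq_zero_or_pos s.card with h | h
    · simp [h]
    · obtain ⟨t, ht⟩ := Nat.exists_eq_add_of_lt h
      simp only [ht] at *
      simp at *
      nlinarith

open Finset in
theorem card_mul_card_sub_one_le_sum_weight {ι : Type*} [Fintype ι] (g : ι → ℕ × ℕ)
    (hg : Function.Injective g) :
    Fintype.card ι * (Fintype.card ι - 1) ≤
      2 * ∑ q, ((g q).1 + Fintype.card ι * (g q).2) := by
  classical
  set N := Fintype.card ι with hN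
  set A := univ.filter fun q => (g q).2 = 0 with hA
  set A' := univ.filter fun q => ¬ (g q).2 = 0 with hA'
  have hcard : A.card + A'.card = N := by
    rw [hN, ← card_univ]; exact card_filter_add_card_filter_not _
  have hinj : Set.InjOn (fun q => (g q).1) A := by
    intro p hp q hq h
    simp [hA] at hp hq
    exact hg (Prod.ext h (hp.trans hq.symm))
  have h1 := card_mul_card_sub_one_le_two_mul_sum (A.image fun q => (g q).1)
  rw [card_image_of_injOn hinj, sum_image hinj] at h1
  have h2 : N * A'.card ≤ ∑ q ∈ A', ((g q).1 + N * (g q).2) := by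
    rw [mul_comm, ← smul_eq_mul]
    apply card_nsmul_le_sum
    intro q hq
    simp [hA'] at hq
    have := Nat.pos_of_ne_zero hq
    nlinarith
  have h3 : ∑ q ∈ A, (g q).1 ≤ ∑ q ∈ A, ((g q).1 + N * (g q).2) :=
    sum_le_sum fun q _ => by omega
  rw [← sum_filter_add_sum_filter_not univ fun q => (g q).2 = 0]
  have hle : A.card ≤ N := by omega
  clear_value N
  generalize A.card = a at *
  generalize A'.card = a' at *
  rcases Nat.eq_zero_or_pos N with h | h
  · simp [h]
  · subst hcard
    have e1 : (a + a') * (a + a' - 1) ≤ a * (a - 1) + 2 * ((a + a') * a') := by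
      rcases Nat.eq_zero_or_pos a with h0 | h0
      · subst h0
        have : 0 + a' - 1 ≤ a' := by omega
        nlinarith
      · obtain ⟨t, rfl⟩ := Nat.exists_eq_add_of_lt h0
        have e2 : 0 + t + 1 + a' - 1 = t + a' := by omega
        have e3 : 0 + t + 1 - 1 = t := by omega
        rw [e2, e3]
        nlinarith
    rw [mul_add]
    refine e1.trans (add_le_add (h1.trans (Nat.mul_le_mul_left 2 h3)) (Nat.mul_le_mul_left 2 h2))

open Finset in
/-- A determinant whose rows are finite combinations of monomials `z a b` is small, because only
distinct monomials contribute. -/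
theorem abs_det_le_of_monomial_expansion {ι σ : Type*} [Fintype ι] [DecidableEq ι]
    (S : Finset σ) (c : ι → σ → ℝ) (e : ι → σ → ℕ × ℕ) (z : ℕ × ℕ → ι → ℝ) (Z : ℕ × ℕ → ℝ)
    (hZ : ∀ m p, |z m p| ≤ Z m) {ρ : ℝ} (hρ : 1 ≤ ρ) :
    |Matrix.det (Matrix.of fun q p => ∑ s ∈ S, c q s * z (e q s) p)| ^ 2 *
      ρ ^ (Fintype.card ι * (Fintype.card ι - 1)) ≤
    ((Fintype.card ι).factorial * ∏ q, ∑ s ∈ S, |c q s| * Z (e q s) *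
      ρ ^ ((e q s).1 + Fintype.card ι * (e q s).2)) ^ 2 := by
  classical
  set N := Fintype.card ι with hN
  have hρ0 : 0 < ρ := by linarith
  have hexp : Matrix.det (Matrix.of fun q p => ∑ s ∈ S, c q s * z (e q s) p) =
      ∑ f ∈ Fintype.piFinset fun _ : ι => S,
        (∏ q, c q (f q)) * Matrix.det (Matrix.of fun q p => z (e q (f q)) p) := by
    have := (Matrix.detRowAlternating (R := ℝ) (n := ι)).toMultilinearMap.map_sum_finset
      (fun q s => (c q s • z (e q s) : ι → ℝ)) (fun _ => S)
    have h2 : (fun q => ∑ s ∈ S, (c q s • z (e q s) : ι → ℝ)) =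
        (Matrix.of fun q p => ∑ s ∈ S, c q s * z (e q s) p) := by
      ext q p; simp
    rw [h2] at this
    refine this.trans (sum_congr rfl fun f _ => ?_)
    exact ((Matrix.detRowAlternating (R := ℝ) (n := ι)).toMultilinearMap.map_smul_univ
      (fun q => c q (f q)) (fun q => z (e q (f q))))
  set w : ℝ := ρ ^ (N * (N - 1)) with hw
  have hw1 : 1 ≤ w := one_le_pow₀ hρ
  have hterm : ∀ f : ι → σ, |(∏ q, c q (f q)) * Matrix.det (Matrix.of fun q p => z (e q (f q)) p)| *
      √w ≤ N.factorial * ∏ q, |c q (f q)| * Z (e q (f q)) *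
        ρ ^ ((e q (f q)).1 + N * (e q (f q)).2) := by
    intro f
    have hZ0 : ∀ q, 0 ≤ Z (e q (f q)) := fun q => (abs_nonneg _).trans (hZ _ q)
    by_cases hinj : Function.Injective fun q => e q (f q)
    · have hwt := card_mul_card_sub_one_le_sum_weight _ hinj
      have hsq : √w ≤ ρ ^ (∑ q, ((e q (f q)).1 + N * (e q (f q)).2)) := by
        rw [Real.sqrt_le_left (by positivity), ← pow_mul, mul_comm]
        exact pow_le_pow_right₀ hρ hwt
      have hdet : |Matrix.det (Matrix.of fun q p => z (e q (f q)) p)| ≤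
          N.factorial * ∏ q, Z (e q (f q)) := by
        rw [Matrix.det_apply]
        refine (abs_sum_le_sum_abs _ _).trans ?_
        have : ∀ τ ∈ (univ : Finset (Equiv.Perm ι)),
            |Equiv.Perm.sign τ • ∏ i, (Matrix.of fun q p => z (e q (f q)) p) (τ i) i| ≤
              ∏ q, Z (e q (f q)) := by
          intro τ _
          rw [← Equiv.prod_comp τ fun q => Z (e q (f q))]
          rcases Int.units_eq_one_or (Equiv.Perm.sign τ) with h | h <;> rw [h] <;>
          · simp only [one_smul, Units.neg_smul, abs_neg, abs_prod, Matrix.of_apply]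
            exact prod_le_prod (fun _ _ => abs_nonneg _) fun i _ => hZ _ _
        refine (sum_le_card_nsmul _ _ _ this).trans ?_
        simp [Fintype.card_perm, hN]
      rw [abs_mul, abs_prod, prod_mul_distrib, prod_mul_distrib, prod_pow_eq_pow_sum]
      calc (∏ q, |c q (f q)|) * |Matrix.det (Matrix.of fun q p => z (e q (f q)) p)| * √w
          ≤ (∏ q, |c q (f q)|) * (N.factorial * ∏ q, Z (e q (f q))) *
            ρ ^ (∑ q, ((e q (f q)).1 + N * (e q (f q)).2)) := by
            have h0 : 0 ≤ ∏ q, Z (e q (f q)) := prod_nonneg fun q _ => hZ0 q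
            gcongr
        _ = _ := by ring
    · have : Matrix.det (Matrix.of fun q p => z (e q (f q)) p) = 0 := by
        simp only [Function.Injective] at hinj
        push Not at hinj
        obtain ⟨i, j, hij, hne⟩ := hinj
        exact Matrix.det_zero_of_row_eq hne (by ext p; simp [hij])
      rw [this]
      simp only [mul_zero, abs_zero, zero_mul]
      have : 0 ≤ ∏ q, |c q (f q)| * Z (e q (f q)) * ρ ^ ((e q (f q)).1 + N * (e q (f q)).2) :=
        prod_nonneg fun q _ => by have := hZ0 q; positivity
      positivity
  have hfin : |Matrix.det (Matrix.of fun q p => ∑ s ∈ S, c q s * z (e q s) p)| * √w ≤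
      N.factorial * ∏ q, ∑ s ∈ S, |c q s| * Z (e q s) * ρ ^ ((e q s).1 + N * (e q s).2) := by
    rw [hexp, prod_univ_sum, mul_sum]
    refine (mul_le_mul_of_nonneg_right (abs_sum_le_sum_abs _ _) (by positivity)).trans ?_
    rw [sum_mul]
    exact sum_le_sum fun f _ => hterm f
  have := pow_le_pow_left₀ (by positivity) hfin 2
  rwa [mul_pow, Real.sq_sqrt (by linarith)] at this

end

section

open Polynomial

open Finset in
theorem Polynomial.coeff_prod_sum_of_natDegree_le {R ι : Type*} [CommSemiring R] (s : Finset ι)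
    (f : ι → R[X]) (d : ι → ℕ) (h : ∀ i ∈ s, (f i).natDegree ≤ d i) :
    (∏ i ∈ s, f i).coeff (∑ i ∈ s, d i) = ∏ i ∈ s, (f i).coeff (d i) := by
  classical
  induction s using Finset.induction_on with
  | empty => simp
  | insert a s ha ih =>
    rw [prod_insert ha, sum_insert ha, prod_insert ha, coeff_mul_add_eq_of_natDegree_le,
      ih fun i hi => h i (mem_insert_of_mem hi)]
    · exact h a (mem_insert_self a s)
    · exact (natDegree_prod_le _ _).trans (sum_le_sum fun i hi => h i (mem_insert_of_mem hi))

theorem Matrix.coeff_det_of_natDegree_le {R ι : Type*} [CommRing R] [Fintype ι] [DecidableEq ι]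
    (A : Matrix ι ι R[X]) (d : ι → ℕ) (h : ∀ i j, (A i j).natDegree ≤ d i) :
    A.det.natDegree ≤ ∑ i, d i ∧
    A.det.coeff (∑ i, d i) = Matrix.det (Matrix.of fun i j => (A i j).coeff (d i)) := by
  have hterm : ∀ σ : Equiv.Perm ι, ∏ i, A (σ i) i = ∏ i, A i (σ.symm i) := fun σ => by
    rw [← Equiv.prod_comp σ fun i => A i (σ.symm i)]; simp
  have hsum : ∀ σ : Equiv.Perm ι, ∑ i, d i = ∑ i, d (σ i) := fun σ => (Equiv.sum_comp σ d).symm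
  constructor
  · rw [Matrix.det_apply]
    refine natDegree_sum_le_of_forall_le _ _ fun σ _ => ?_
    refine (natDegree_smul_le _ _).trans ((natDegree_prod_le _ _).trans ?_)
    rw [hsum σ]
    exact Finset.sum_le_sum fun i _ => h _ _
  · rw [Matrix.det_apply, Matrix.det_apply, finsetSum_coeff]
    refine Finset.sum_congr rfl fun σ _ => ?_
    rw [coeff_smul, hsum σ, coeff_prod_sum_of_natDegree_le _ _ _ fun i _ => h _ _]
    rfl

/-- Zero estimate for polynomials in `X` and `Y` on the points `(i r + j x, b ^ i a ^ j)`. -/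
theorem eq_zero_of_eval_lattice_eq_zero {K L R S r x : ℕ} {a b : ℝ} (ha : 1 < a) (hb : b ≠ 0)
    (Q : Fin L → ℝ[X]) (hdeg : ∀ l, (Q l).natDegree ≤ K)
    (hdist : Set.InjOn (fun q : ℕ × ℕ => q.1 * r + q.2 * x)
      (Finset.range R ×ˢ Finset.range S : Finset (ℕ × ℕ)))
    (hcount : L * K < R * S)
    (hvan : ∀ i < R, ∀ j < S + L,
      ∑ l, (Q l).eval ((i * r + j * x : ℕ) : ℝ) * (b ^ i * a ^ j) ^ (l : ℕ) = 0) :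
    ∀ l, Q l = 0 := by
  classical
  by_contra! hne
  obtain ⟨l₀, hl₀⟩ := hne
  set M := Finset.univ.filter fun l => Q l ≠ 0 with hM
  set m := M.card with hm
  have hmL : m ≤ L := by simpa using M.card_le_univ
  have hm0 : 0 < m := Finset.card_pos.2 ⟨l₀, by simp [hM, hl₀]⟩
  set g : Fin m → Fin L := fun k => M.orderEmbOfFin rfl k with hg
  have hginj : Function.Injective g := (M.orderEmbOfFin rfl).injective
  have hgM : ∀ k, Q (g k) ≠ 0 := fun k => by
    have := M.orderEmbOfFin_mem rfl k
    exact (Finset.mem_filter.1 this).2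
  set A : Matrix (Fin m) (Fin m) ℝ[X] := Matrix.of fun k j =>
    (Q (g k)).comp (X + C (((j : ℕ) * x : ℕ) : ℝ)) * C ((a ^ (g k : ℕ)) ^ (j : ℕ)) with hA
  have hpow : ∀ k j : ℕ, (a ^ k) ^ j ≠ 0 := fun k j => by positivity
  have hAdeg : ∀ k j, (A k j).natDegree ≤ (Q (g k)).natDegree := fun k j => by
    rw [hA, Matrix.of_apply, natDegree_mul_C (hpow _ _), natDegree_comp, natDegree_X_add_C, mul_one]
  obtain ⟨hD, hcoeff⟩ := Matrix.coeff_det_of_natDegree_le A (fun k => (Q (g k)).natDegree) hAdeg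
  have hAc : (Matrix.of fun k j => (A k j).coeff (Q (g k)).natDegree) =
      Matrix.of fun k j => (Q (g k)).leadingCoeff *
        Matrix.vandermonde (fun k : Fin m => a ^ (g k : ℕ)) k j := by
    ext k j
    simp only [hA, Matrix.of_apply, coeff_mul_C, Matrix.vandermonde_apply]
    congr 1
    have h1 : ((Q (g k)).comp (X + C (((j : ℕ) * x : ℕ) : ℝ))).natDegree =
        (Q (g k)).natDegree := by
      rw [natDegree_comp, natDegree_X_add_C, mul_one]
    rw [← h1, coeff_natDegree, leadingCoeff_comp (by rw [natDegree_X_add_C]; simp),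
      leadingCoeff_X_add_C]
    simp
  have hdet : A.det ≠ 0 := by
    intro h0
    rw [h0, hAc, Matrix.det_mul_column, coeff_zero] at hcoeff
    rcases mul_eq_zero.1 hcoeff.symm with h | h
    · obtain ⟨k, -, hk⟩ := Finset.prod_eq_zero_iff.1 h
      exact hgM k (leadingCoeff_eq_zero.1 hk)
    · refine Matrix.det_vandermonde_ne_zero_iff.2 ?_ h
      intro k k' hkk
      have := pow_right_injective₀ (by linarith) ha.ne' hkk
      exact hginj (Fin.ext this)
  apply hdet
  apply eq_zero_of_natDegree_lt_card_of_eval_eq_zero' A.det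
    ((Finset.range R ×ˢ Finset.range S).image fun q : ℕ × ℕ => ((q.1 * r + q.2 * x : ℕ) : ℝ))
  · intro ζ hζ
    obtain ⟨⟨i, j⟩, hij, rfl⟩ := Finset.mem_image.1 hζ
    simp only [Finset.mem_product, Finset.mem_range] at hij
    rw [← coe_evalRingHom, RingHom.map_det, ← Matrix.exists_vecMul_eq_zero_iff]
    refine ⟨fun k => (b ^ i * a ^ j) ^ (g k : ℕ), ?_, ?_⟩
    · intro h
      have := congrFun h ⟨0, hm0⟩
      simp only [Pi.zero_apply] at this
      have h2 : b ^ i * a ^ j ≠ 0 := by positivity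
      exact pow_ne_zero _ h2 this
    · ext j'
      have hj' := j'.2
      have hv := hvan i hij.1 (j + j') (by omega)
      rw [← Finset.sum_filter_of_ne (p := fun l => Q l ≠ 0) (fun l _ hl h0 => hl (by simp [h0]))]
        at hv
      have himg : Finset.univ.filter (fun l => Q l ≠ 0) = Finset.univ.map
          (M.orderEmbOfFin rfl).toEmbedding := by
        rw [← hM]
        exact (Finset.map_orderEmbOfFin_univ M rfl).symm
      rw [himg, Finset.sum_map] at hv
      rw [Pi.zero_apply, ← hv]
      simp only [Matrix.vecMul, dotProduct, RingHom.mapMatrix_apply, Matrix.map_apply, hA,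
        Matrix.of_apply, coe_evalRingHom, eval_mul, eval_comp, eval_add, eval_X, eval_C]
      refine Finset.sum_congr rfl fun k _ => ?_
      have : (((i * r + (j + j') * x : ℕ)) : ℝ) =
          ((i * r + j * x : ℕ) : ℝ) + ((j' * x : ℕ) : ℝ) := by
        push_cast; ring
      simp only [this]
      simp only [RelEmbedding.coe_toEmbedding]
      ring
  · rw [Finset.card_image_of_injOn]
    · calc A.det.natDegree ≤ ∑ k, (Q (g k)).natDegree := hD
        _ ≤ ∑ k : Fin m, K := Finset.sum_le_sum fun k _ => hdeg _
        _ = m * K := by simp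
        _ ≤ L * K := Nat.mul_le_mul_right _ hmL
        _ < _ := by simpa using hcount
    · intro p hp q hq h
      exact hdist hp hq (Nat.cast_injective (R := ℝ) h)

theorem exists_det_ne_zero_of_forall_sum_eq_zero {ι P : Type*} [Fintype ι] [DecidableEq ι]
    (f : ι → P → ℝ) (h : ∀ c : ι → ℝ, (∀ p, ∑ q, c q * f q p = 0) → c = 0) :
    ∃ g : ι → P, Matrix.det (Matrix.of fun q q' => f q (g q')) ≠ 0 := by
  set v : P → ι → ℝ := fun p q => f q p with hv
  have hspan : Submodule.span ℝ (Set.range v) = ⊤ := by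
    by_contra hlt
    obtain ⟨φ, hφ, hle⟩ := Submodule.exists_le_ker_of_lt_top _ (lt_top_iff_ne_top.2 hlt)
    apply hφ
    have hc := h (fun q => φ (Pi.single q 1)) fun p => by
      have h1 : φ (v p) = 0 := hle (Submodule.subset_span ⟨p, rfl⟩)
      rw [LinearMap.pi_apply_eq_sum_univ φ (v p)] at h1
      rw [← h1]
      refine Finset.sum_congr rfl fun q _ => ?_
      rw [smul_eq_mul, mul_comm]
      congr 2
      ext q'
      simp [Pi.single_apply, eq_comm]
    refine LinearMap.pi_ext' fun q => LinearMap.ext_ring ?_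
    simpa using congrFun hc q
  obtain ⟨κ, a, -, hsp, hli⟩ := exists_linearIndependent' ℝ v
  rw [hspan] at hsp
  let B := Module.Basis.mk hli hsp.ge
  let e : ι ≃ κ := (Pi.basisFun ℝ ι).indexEquiv B
  refine ⟨a ∘ e, ?_⟩
  have hli' : LinearIndependent ℝ fun q' => v (a (e q')) := hli.comp e e.injective
  rw [← Matrix.det_transpose]
  have : LinearIndependent ℝ (Matrix.of fun q q' => f q ((a ∘ e) q')).transpose.row := hli'
  rw [Matrix.linearIndependent_rows_iff_isUnit, Matrix.isUnit_iff_isUnit_det] at this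
  exact this.ne_zero

theorem Matrix.abs_det_le_factorial_mul_prod {ι : Type*} [Fintype ι] [DecidableEq ι]
    (A : Matrix ι ι ℝ) (Z : ι → ℝ) (h : ∀ q p, |A q p| ≤ Z q) :
    |A.det| ≤ (Fintype.card ι).factorial * ∏ q, Z q := by
  rw [Matrix.det_apply]
  refine (Finset.abs_sum_le_sum_abs _ _).trans ?_
  have : ∀ τ ∈ (Finset.univ : Finset (Equiv.Perm ι)),
      |Equiv.Perm.sign τ • ∏ i, A (τ i) i| ≤ ∏ q, Z q := by
    intro τ _
    rw [← Equiv.prod_comp τ fun q => Z q]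
    rcases Int.units_eq_one_or (Equiv.Perm.sign τ) with h1 | h1 <;> rw [h1] <;>
    · simp only [one_smul, Units.neg_smul, abs_neg, Finset.abs_prod]
      exact Finset.prod_le_prod (fun _ _ => abs_nonneg _) fun i _ => h _ _
  refine (Finset.sum_le_card_nsmul _ _ _ this).trans ?_
  simp [Fintype.card_perm]

theorem Real.tendsto_sum_range_pow_div_factorial (x : ℝ) :
    Filter.Tendsto (fun T => ∑ a ∈ Finset.range T, x ^ a / a.factorial) Filter.atTop
      (nhds (Real.exp x)) := by
  rw [Real.exp_eq_exp_ℝ]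
  exact (NormedSpace.expSeries_div_hasSum_exp x).tendsto_sum_nat

/-- An interpolation determinant in `ζ ^ k * exp (l * (c * ζ + u))` is small when `u` is. -/
theorem abs_det_pow_mul_exp_le {ι : Type*} [Fintype ι] [DecidableEq ι] (k l : ι → ℕ)
    (ζ u : ι → ℝ) {B U c ρ : ℝ} (hc : 0 ≤ c) (hρ : 1 ≤ ρ) (hB : 0 ≤ B) (hU : 0 ≤ U)
    (hζ : ∀ p, |ζ p| ≤ B) (hu : ∀ p, |u p| ≤ U) :
    |Matrix.det (Matrix.of fun q p => ζ p ^ k q * Real.exp (l q * (c * ζ p + u p)))| ^ 2 *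
      ρ ^ (Fintype.card ι * (Fintype.card ι - 1)) ≤
    ((Fintype.card ι).factorial * ∏ q, ((ρ * B) ^ k q * Real.exp (l q * (c * (ρ * B))) *
      Real.exp (l q * (U * ρ ^ Fintype.card ι)))) ^ 2 := by
  set N := Fintype.card ι with hN
  have key : ∀ T : ℕ, |Matrix.det (Matrix.of fun q p => ζ p ^ k q *
      ((∑ a ∈ Finset.range T, (l q * (c * ζ p)) ^ a / a.factorial) *
        ∑ a ∈ Finset.range T, (l q * u p) ^ a / a.factorial))| ^ 2 *
      ρ ^ (N * (N - 1)) ≤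
      (N.factorial * ∏ q, ((ρ * B) ^ k q * Real.exp (l q * (c * (ρ * B))) *
      Real.exp (l q * (U * ρ ^ N)))) ^ 2 := by
    intro T
    have h1 := abs_det_le_of_monomial_expansion (ι := ι) (Finset.range T ×ˢ Finset.range T)
      (fun q s => (l q * c) ^ s.1 / s.1.factorial * ((l q : ℝ) ^ s.2 / s.2.factorial))
      (fun q s => (k q + s.1, s.2)) (fun m p => ζ p ^ m.1 * u p ^ m.2)
      (fun m => B ^ m.1 * U ^ m.2) (fun m p => by
        rw [abs_mul, abs_pow, abs_pow]
        have := hζ p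
        have := hu p
        gcongr) hρ
    have h2 : ∀ q p, ζ p ^ k q *
      ((∑ a ∈ Finset.range T, (l q * (c * ζ p)) ^ a / a.factorial) *
        ∑ a ∈ Finset.range T, (l q * u p) ^ a / a.factorial) =
        ∑ s ∈ Finset.range T ×ˢ Finset.range T,
          (l q * c) ^ s.1 / s.1.factorial * ((l q : ℝ) ^ s.2 / s.2.factorial) *
            (ζ p ^ (k q + s.1) * u p ^ s.2) := by
      intro q p
      rw [Finset.sum_mul_sum, Finset.sum_product, Finset.mul_sum]
      refine Finset.sum_congr rfl fun a _ => ?_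
      rw [Finset.mul_sum]
      refine Finset.sum_congr rfl fun b _ => ?_
      rw [mul_pow, mul_pow, mul_pow, mul_pow, pow_add]
      ring
    simp only [h2]
    refine h1.trans ?_
    have h3 : ∀ q, 0 ≤ ∑ s ∈ Finset.range T ×ˢ Finset.range T,
        |(l q * c) ^ s.1 / s.1.factorial * ((l q : ℝ) ^ s.2 / s.2.factorial)| *
          (B ^ (k q + s.1) * U ^ s.2) * ρ ^ (k q + s.1 + N * s.2) := fun q =>
      Finset.sum_nonneg fun s _ => by positivity
    refine pow_le_pow_left₀ (mul_nonneg (by positivity) (Finset.prod_nonneg fun q _ => h3 q)) ?_ 2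
    refine mul_le_mul_of_nonneg_left (Finset.prod_le_prod (fun q _ => h3 q) fun q _ => ?_)
      (by positivity)
    have h4 : ∑ s ∈ Finset.range T ×ˢ Finset.range T,
        |(l q * c) ^ s.1 / s.1.factorial * ((l q : ℝ) ^ s.2 / s.2.factorial)| *
          (B ^ (k q + s.1) * U ^ s.2) * ρ ^ (k q + s.1 + N * s.2) =
        (ρ * B) ^ k q * (∑ a ∈ Finset.range T, (l q * (c * (ρ * B))) ^ a / a.factorial) *
        ∑ a ∈ Finset.range T, (l q * (U * ρ ^ N)) ^ a / a.factorial := by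
      rw [mul_assoc, Finset.sum_mul_sum, Finset.sum_product, Finset.mul_sum]
      refine Finset.sum_congr rfl fun a _ => ?_
      rw [Finset.mul_sum]
      refine Finset.sum_congr rfl fun b _ => ?_
      rw [abs_of_nonneg (by positivity)]
      simp only [mul_pow, pow_add, pow_mul]
      ring
    rw [h4]
    gcongr
    · exact Real.sum_le_exp_of_nonneg (by positivity) T
    · exact Real.sum_le_exp_of_nonneg (by positivity) T
  have hlim := fun (f : ℕ → Matrix ι ι ℝ) (A : Matrix ι ι ℝ)
      (h : Filter.Tendsto f Filter.atTop (nhds A)) =>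
    (((((continuous_id.matrix_det).tendsto A).comp h).abs).pow 2).mul_const (ρ ^ (N * (N - 1)))
  refine le_of_tendsto' (hlim _ _ ?_) key
  refine tendsto_pi_nhds.2 fun q => tendsto_pi_nhds.2 fun p => ?_
  simp only [Matrix.of_apply]
  rw [mul_add, Real.exp_add]
  exact ((Real.tendsto_sum_range_pow_div_factorial _).mul
    (Real.tendsto_sum_range_pow_div_factorial _)).const_mul _

end

section

open Polynomial Real goldenRatio
open scoped goldenRatio

theorem exists_interpolation_det_ne_zero {K L R S r x : ℕ} {a b : ℝ} (ha : 1 < a) (hb : b ≠ 0)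
    (hR : R ≤ x) (hcop : Nat.Coprime r x) (hcount : L * (K - 1) < R * S) :
    ∃ g : Fin K × Fin L → Fin R × Fin (S + L), Matrix.det (Matrix.of fun q q' =>
      (((g q').1 * r + (g q').2 * x : ℕ) : ℝ) ^ (q.1 : ℕ) *
        (b ^ ((g q').1 : ℕ) * a ^ ((g q').2 : ℕ)) ^ (q.2 : ℕ)) ≠ 0 := by
  refine exists_det_ne_zero_of_forall_sum_eq_zero (P := Fin R × Fin (S + L))
    (fun (q : Fin K × Fin L) p => ((p.1 * r + p.2 * x : ℕ) : ℝ) ^ (q.1 : ℕ) *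
        (b ^ (p.1 : ℕ) * a ^ (p.2 : ℕ)) ^ (q.2 : ℕ)) fun c hc => ?_
  have hQ := eq_zero_of_eval_lattice_eq_zero (K := K - 1) (R := R) (S := S) (r := r) (x := x)
    ha hb (fun l : Fin L => ∑ k : Fin K, C (c (k, l)) * X ^ (k : ℕ)) (fun l => ?_) ?_ hcount ?_
  · ext ⟨k, l⟩
    have h1 := congrArg (fun p => coeff p k) (hQ l)
    simpa [coeff_X_pow, Fin.val_inj] using h1
  · refine natDegree_sum_le_of_forall_le _ _ fun k _ => (natDegree_C_mul_X_pow_le _ _).trans ?_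
    omega
  · rintro ⟨i, j⟩ hij ⟨i', j'⟩ hij' h
    simp only [Finset.coe_product, Finset.coe_range, Set.mem_prod, Set.mem_Iio] at hij hij' h
    have hx : 0 < x := by omega
    have hi : i = i' := by
      have h2 : i * r ≡ i' * r [MOD x] := by
        have h3 : (i * r + j * x) % x = (i' * r + j' * x) % x := by rw [h]
        simpa [Nat.ModEq] using h3
      have h4 := Nat.ModEq.cancel_right_of_coprime (Nat.coprime_comm.1 hcop) h2
      exact Nat.ModEq.eq_of_lt_of_lt h4 (by omega) (by omega)
    subst hi
    have : j = j' := Nat.eq_of_mul_eq_mul_right hx (by omega)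
    rw [this]
  · intro i hi j hj
    rw [← hc (⟨i, hi⟩, ⟨j, hj⟩), Fintype.sum_prod_type_right]
    refine Finset.sum_congr rfl fun l _ => ?_
    rw [eval_finsetSum, Finset.sum_mul]
    refine Finset.sum_congr rfl fun k _ => ?_
    simp [mul_assoc]

theorem goldenRatio_lt : φ < 809017 / 500000 := by
  have h : √5 < 559017 / 250000 := by
    rw [Real.sqrt_lt' (by norm_num)]; norm_num
  unfold goldenRatio; linarith

theorem natCast_pow_lt_pow_of_interpolation {H L : ℕ} (hH : 4 ≤ H) (hL : 12 ≤ L) :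
    (((100 * H * L * L : ℕ) : ℝ)) ^ 4 * 8 ^ (100 * H * L - 1) * (3 ^ L) ^ (100 * H * L - 1) *
      φ ^ (173 * H * L * (L - 1)) < 8 ^ (100 * H * L * L - 1) := by
  have hφ : φ ^ 173 * (347 / 100) ^ 100 ≤ 8 ^ 100 := by
    have h1 := pow_le_pow_left₀ goldenRatio_pos.le goldenRatio_lt.le 173
    refine (mul_le_mul_of_nonneg_right h1 (by positivity)).trans ?_
    norm_num
  obtain ⟨t, rfl⟩ := Nat.exists_eq_add_of_le hL
  obtain ⟨M, hM⟩ : ∃ M, M = H * (12 + t) := ⟨_, rfl⟩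
  have hM1 : 4 * (12 + t) ≤ M := by rw [hM]; exact Nat.mul_le_mul_right _ hH
  have e1 : 100 * H * (12 + t) = 100 * M := by rw [hM]; ring
  have e2 : 173 * H * (12 + t) = 173 * M := by rw [hM]; ring
  have e3 : 12 + t - 1 = 11 + t := by omega
  rw [e1, e2, e3]
  have h3 : (3 : ℝ) ^ (12 + t) * (8 / 5) ≤ (347 / 100) ^ (11 + t) := by
    rw [pow_add, pow_add]
    have : (3 : ℝ) ^ t ≤ (347 / 100) ^ t := by gcongr; norm_num
    nlinarith [pow_pos (show (0 : ℝ) < 3 by norm_num) t]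
  have h4 : ((100 * M * (12 + t) : ℕ) : ℝ) ^ 4 < ((8 / 5) ^ 100) ^ M := by
    have h5 : 100 * M * (12 + t) ≤ (100 * M) ^ 2 := by
      rw [sq]; exact Nat.mul_le_mul_left _ (by omega)
    have h6 : 100 * M < 256 ^ M := by
      have h7 : M < 2 ^ M := Nat.lt_two_pow_self
      have h8 : 128 ^ 1 ≤ 128 ^ M := Nat.pow_le_pow_right (by norm_num) (by omega)
      calc 100 * M ≤ 128 ^ M * M := Nat.mul_le_mul_right _ (by omega)
        _ < 128 ^ M * 2 ^ M := by gcongr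
        _ = 256 ^ M := by rw [← mul_pow]; norm_num
    calc ((100 * M * (12 + t) : ℕ) : ℝ) ^ 4 ≤ (((100 * M) ^ 2 : ℕ) : ℝ) ^ 4 := by
          gcongr
      _ < (((256 ^ M) ^ 2 : ℕ) : ℝ) ^ 4 := by
          gcongr
      _ = ((256 : ℝ) ^ 8) ^ M := by
          push_cast
          rw [← pow_mul, ← pow_mul, ← pow_mul]
          congr 1
          ring
      _ ≤ _ := by
          gcongr
          norm_num
  have h5 : ((8 / 5 : ℝ) ^ 100) ^ M * (3 ^ (12 + t)) ^ (100 * M) * φ ^ (173 * M * (11 + t)) ≤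
      8 ^ (100 * M * (11 + t)) := by
    calc ((8 / 5 : ℝ) ^ 100) ^ M * (3 ^ (12 + t)) ^ (100 * M) * φ ^ (173 * M * (11 + t))
        = (3 ^ (12 + t) * (8 / 5)) ^ (100 * M) * (φ ^ 173) ^ (M * (11 + t)) := by
          rw [mul_pow, ← pow_mul, ← pow_mul φ]; ring
      _ ≤ ((347 / 100) ^ (11 + t)) ^ (100 * M) * (φ ^ 173) ^ (M * (11 + t)) := by
          gcongr
      _ = (φ ^ 173 * (347 / 100) ^ 100) ^ (M * (11 + t)) := by
          rw [mul_pow, ← pow_mul, ← pow_mul, ← pow_mul]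
          ring
      _ ≤ (8 ^ 100) ^ (M * (11 + t)) := by
          have := goldenRatio_pos
          gcongr
      _ = _ := by rw [← pow_mul]; ring
  have e4 : (8 : ℝ) ^ (100 * M * (12 + t) - 1) =
      8 ^ (100 * M - 1) * 8 ^ (100 * M * (11 + t)) := by
    rw [← pow_add]
    congr 1
    have : 100 * M * (12 + t) = 100 * M + 100 * M * (11 + t) := by ring
    omega
  rw [e4]
  have hp := goldenRatio_pos
  calc _ = 8 ^ (100 * M - 1) * (((100 * M * (12 + t) : ℕ) : ℝ) ^ 4 *
        (3 ^ (12 + t)) ^ (100 * M - 1) * φ ^ (173 * M * (11 + t))) := by ring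
    _ < 8 ^ (100 * M - 1) * (((8 / 5) ^ 100) ^ M * (3 ^ (12 + t)) ^ (100 * M) *
        φ ^ (173 * M * (11 + t))) := by
        gcongr ?_ * (?_ * _)
        refine mul_lt_mul h4 ?_ (by positivity) (by positivity)
        exact pow_le_pow_right₀ (one_le_pow₀ (by norm_num)) (by omega)
    _ ≤ _ := by gcongr

theorem prod_pow_fst_mul_pow_snd_sq (K L : ℕ) (A D : ℝ) :
    (∏ q : Fin K × Fin L, A ^ (q.1 : ℕ) * D ^ (q.2 : ℕ)) ^ 2 =
      (A ^ (K - 1) * D ^ (L - 1)) ^ (K * L) := by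
  have hsum : ∀ n : ℕ, (∑ i : Fin n, (i : ℕ)) * 2 = n * (n - 1) := fun n => by
    rw [Fin.sum_univ_eq_sum_range (fun i => i), Finset.sum_range_id_mul_two]
  rw [Finset.prod_mul_distrib, Finset.prod_pow_eq_pow_sum, Finset.prod_pow_eq_pow_sum,
    Fintype.sum_prod_type, Fintype.sum_prod_type_right, mul_pow, mul_pow, ← pow_mul, ← pow_mul,
    ← pow_mul, ← pow_mul]
  simp only [Finset.sum_const, Finset.card_univ, Fintype.card_fin, smul_eq_mul]
  rw [← Finset.mul_sum, ← Finset.mul_sum, mul_assoc, mul_assoc, hsum, hsum]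
  congr 2 <;> ring

theorem exp_one_le_goldenRatio_pow : Real.exp 1 ≤ φ ^ 3 := by
  have h1 := Real.exp_one_lt_d9
  have h2 : φ ^ 3 = 2 * φ + 1 := by
    linear_combination (φ + 1) * goldenRatio_sq
  have := one_lt_goldenRatio
  linarith

theorem pow_mul_pow_eq_exp {x i j r : ℕ} {b : ℝ} (hb : 0 < b) (hx : 0 < x) :
    b ^ i * φ ^ j = Real.exp (log φ / x * (i * r + j * x : ℕ) +
      i * (x * log b - r * log φ) / x) := by
  have hx' : (x : ℝ) ≠ 0 := by positivity
  have : log φ / x * (i * r + j * x : ℕ) + i * (x * log b - r * log φ) / x =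
      i * log b + j * log φ := by
    push_cast; field_simp; ring
  rw [this, Real.exp_add, ← Real.log_pow, ← Real.log_pow, Real.exp_log (by positivity),
    Real.exp_log (pow_pos goldenRatio_pos _)]

theorem lt_abs_linear_form_of_coprime {b H L x r : ℕ} (hb : 2 ≤ b) (hH : 4 ≤ H) (hL : 12 ≤ L)
    (hbH : (b : ℝ) ≤ φ ^ H) (hx : 10 * L ≤ x) (hr : r ≤ H * x) (hcop : Nat.Coprime r x)
    (hB : (x * L * (20 * H + 1)) ^ 2 ≤ 3 ^ L) :
    (1 / 8 : ℝ) ^ (100 * H * L * L) < |x * log b - r * log φ| := by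
  by_contra! hΛ
  set Λ : ℝ := x * log b - r * log φ with hΛdef
  have hb0 : (0 : ℝ) < b := by exact_mod_cast (by omega : 0 < b)
  have hx0 : 0 < x := by omega
  have hφ := goldenRatio_pos
  have hφ1 := one_lt_goldenRatio
  obtain ⟨K, hK⟩ : ∃ K, K = 100 * H * L := ⟨_, rfl⟩
  have hK0 : 0 < K := by rw [hK]; positivity
  rw [← hK] at hΛ
  obtain ⟨B, hBd⟩ : ∃ B, B = x * L * (20 * H + 1) := ⟨_, rfl⟩
  rw [← hBd] at hB
  obtain ⟨g, hg⟩ := exists_interpolation_det_ne_zero (K := K) (L := L) (R := 10 * L)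
    (S := 10 * H * L) (r := r) (x := x) (a := φ) (b := b) hφ1 hb0.ne' hx hcop (by
      have : 10 * L * (10 * H * L) = L * K := by rw [hK]; ring
      rw [this]
      exact Nat.mul_lt_mul_of_pos_left (by omega) (by omega))
  set ζ : Fin K × Fin L → ℕ := fun p => (g p).1 * r + (g p).2 * x with hζ
  have hζB : ∀ p, ζ p ≤ B := fun p => by
    have h1 : ((g p).1 : ℕ) ≤ 10 * L := (g p).1.2.le
    have h2 : ((g p).2 : ℕ) ≤ 10 * H * L + L := (g p).2.2.le
    calc ζ p ≤ 10 * L * (H * x) + (10 * H * L + L) * x :=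
          add_le_add (Nat.mul_le_mul h1 hr) (Nat.mul_le_mul_right _ h2)
      _ = B := by rw [hBd]; ring
  set D : ℝ → Matrix (Fin K × Fin L) (Fin K × Fin L) ℝ := fun y => Matrix.of fun q q' =>
    (ζ q' : ℝ) ^ (q.1 : ℕ) * ((b : ℝ) ^ ((g q').1 : ℕ) * y ^ ((g q').2 : ℕ)) ^ (q.2 : ℕ) with hD
  set P : ℤ[X] := Matrix.det (Matrix.of fun q q' => C ((ζ q' : ℤ) ^ ((q : Fin K × Fin L).1 : ℕ)) *
    (C ((b : ℤ) ^ ((g q').1 : ℕ)) * X ^ ((g q').2 : ℕ)) ^ (q.2 : ℕ)) with hP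
  have hPD : ∀ y, aeval y P = (D y).det := fun y => by
    rw [hP, AlgHom.map_det]
    congr 1
    ext q q'
    simp [hD]
  have hDa : ∀ y q p, D y q p = (ζ p : ℝ) ^ (q.1 : ℕ) *
    ((b : ℝ) ^ ((g p).1 : ℕ) * y ^ ((g p).2 : ℕ)) ^ (q.2 : ℕ) := fun _ _ _ => rfl
  have hcard : Fintype.card (Fin K × Fin L) = K * L := by simp
  have hone := one_le_abs_eval_mul_abs_eval P (by rw [hPD]; exact hg)
  rw [hPD, hPD] at hone
  have hψ : |(D ψ).det| ≤ (K * L).factorial *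
      ∏ q : Fin K × Fin L, (B : ℝ) ^ (q.1 : ℕ) * (φ ^ (10 * H * L)) ^ (q.2 : ℕ) := by
    rw [← hcard]
    refine Matrix.abs_det_le_factorial_mul_prod _ _ fun q p => ?_
    have h1 : |ψ| ≤ 1 := by
      rw [abs_le]
      exact ⟨neg_one_lt_goldenConj.le, goldenConj_neg.le.trans zero_le_one⟩
    rw [hDa, abs_mul, abs_pow, abs_pow, abs_mul, abs_pow, abs_pow,
      Nat.abs_cast, Nat.abs_cast]
    have h2 : (b : ℝ) ^ ((g p).1 : ℕ) * |ψ| ^ ((g p).2 : ℕ) ≤ φ ^ (10 * H * L) := by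
      calc (b : ℝ) ^ ((g p).1 : ℕ) * |ψ| ^ ((g p).2 : ℕ)
          ≤ (φ ^ H) ^ ((g p).1 : ℕ) * 1 := by
            gcongr
            exact pow_le_one₀ (abs_nonneg _) h1
        _ ≤ (φ ^ H) ^ (10 * L) * 1 := by
            gcongr
            · exact one_le_pow₀ hφ1.le
            · exact (g p).1.2.le
        _ = _ := by rw [mul_one, ← pow_mul]; congr 1; ring
    have := hζB p
    gcongr
  have hφb : |(D φ).det| ^ 2 * 8 ^ (K * L * (K * L - 1)) ≤ ((K * L).factorial *
      ∏ q : Fin K × Fin L, (8 * B : ℝ) ^ (q.1 : ℕ) *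
        (φ ^ (8 * L * (20 * H + 1) + 3)) ^ (q.2 : ℕ)) ^ 2 := by
    have h1 := abs_det_pow_mul_exp_le (ι := Fin K × Fin L) (fun q => q.1) (fun q => q.2)
      (fun p => ζ p) (fun p => (g p).1 * Λ / x) (B := B) (U := |Λ|) (c := log φ / x) (ρ := 8)
      (by have := Real.log_nonneg hφ1.le; positivity) (by norm_num) (by positivity)
      (abs_nonneg _) (fun p => by rw [Nat.abs_cast]; exact_mod_cast hζB p) (fun p => by
        rw [abs_div, abs_mul, Nat.abs_cast, Nat.abs_cast, div_le_iff₀ (by positivity), mul_comm]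
        have : (((g p).1 : ℕ) : ℝ) ≤ x := by exact_mod_cast (g p).1.2.le.trans hx
        gcongr)
    rw [hcard] at h1
    have h2 : (Matrix.of fun (q p : Fin K × Fin L) => (ζ p : ℝ) ^ (q.1 : ℕ) *
        Real.exp (q.2 * (log φ / x * ζ p + (g p).1 * Λ / x))) = D φ := by
      ext q p
      rw [hDa, Matrix.of_apply, pow_mul_pow_eq_exp (r := r) hb0 hx0,
        ← Real.exp_nat_mul]
    rw [h2] at h1
    refine h1.trans (pow_le_pow_left₀ (by positivity) ?_ 2)
    refine mul_le_mul_of_nonneg_left (Finset.prod_le_prod (fun q _ => by positivity) fun q _ => ?_)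
      (by positivity)
    have h3 : |Λ| * 8 ^ (K * L) ≤ 1 := by
      refine (mul_le_mul_of_nonneg_right hΛ (by positivity)).trans ?_
      rw [← mul_pow]; norm_num
    have h4 : Real.exp ((q.2 : ℕ) * (|Λ| * 8 ^ (K * L))) ≤ (φ ^ 3) ^ (q.2 : ℕ) := by
      rw [Real.exp_nat_mul]
      gcongr
      exact (Real.exp_le_exp.2 h3).trans exp_one_le_goldenRatio_pow
    have h5 : Real.exp ((q.2 : ℕ) * (log φ / x * (8 * B))) =
        (φ ^ (8 * L * (20 * H + 1))) ^ (q.2 : ℕ) := by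
      rw [Real.exp_nat_mul]
      congr 1
      have : log φ / x * (8 * B) = (8 * L * (20 * H + 1) : ℕ) * log φ := by
        rw [hBd]; push_cast; field_simp
      rw [this, Real.exp_nat_mul, Real.exp_log hφ]
    rw [h5, pow_add φ, mul_pow (φ ^ _), mul_assoc ((8 * B : ℝ) ^ _)]
    exact mul_le_mul_of_nonneg_left (mul_le_mul_of_nonneg_left h4 (by positivity)) (by positivity)
  have hcomb : (8 : ℝ) ^ (K * L * (K * L - 1)) ≤
      ((K * L).factorial * ∏ q : Fin K × Fin L, (8 * B : ℝ) ^ (q.1 : ℕ) *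
        (φ ^ (8 * L * (20 * H + 1) + 3)) ^ (q.2 : ℕ)) ^ 2 *
      ((K * L).factorial * ∏ q : Fin K × Fin L, (B : ℝ) ^ (q.1 : ℕ) *
        (φ ^ (10 * H * L)) ^ (q.2 : ℕ)) ^ 2 := by
    calc (8 : ℝ) ^ (K * L * (K * L - 1))
        ≤ (|(D φ).det| * |(D ψ).det|) ^ 2 * 8 ^ (K * L * (K * L - 1)) :=
          le_mul_of_one_le_left (by positivity) (one_le_pow₀ hone)
      _ = |(D φ).det| ^ 2 * 8 ^ (K * L * (K * L - 1)) * |(D ψ).det| ^ 2 := by ring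
      _ ≤ _ := by gcongr
  rw [mul_pow, mul_pow _ _ 2, prod_pow_fst_mul_pow_snd_sq, prod_pow_fst_mul_pow_snd_sq] at hcomb
  have hfac : ((K * L).factorial : ℝ) ≤ (K * L : ℕ) ^ (K * L) := by
    exact_mod_cast Nat.factorial_le_pow _
  have hB' : (B : ℝ) ^ 2 ≤ 3 ^ L := by exact_mod_cast hB
  have hexp : 8 * L * (20 * H + 1) + 3 + 10 * H * L ≤ 173 * H * L := by nlinarith
  have hfin : ((8 : ℝ) ^ (K * L - 1)) ^ (K * L) ≤
      (((K * L : ℕ) : ℝ) ^ 4 * 8 ^ (K - 1) * (3 ^ L) ^ (K - 1) *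
        φ ^ (173 * H * L * (L - 1))) ^ (K * L) := by
    calc ((8 : ℝ) ^ (K * L - 1)) ^ (K * L) = 8 ^ (K * L * (K * L - 1)) := by
          rw [← pow_mul, mul_comm]
      _ ≤ _ := hcomb
      _ ≤ (((K * L : ℕ) : ℝ) ^ (K * L)) ^ 2 * ((8 * B) ^ (K - 1) *
            (φ ^ (8 * L * (20 * H + 1) + 3)) ^ (L - 1)) ^ (K * L) *
          ((((K * L : ℕ) : ℝ) ^ (K * L)) ^ 2 * ((B : ℝ) ^ (K - 1) *
            (φ ^ (10 * H * L)) ^ (L - 1)) ^ (K * L)) := by gcongr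
      _ = (((K * L : ℕ) : ℝ) ^ 4 * 8 ^ (K - 1) * ((B : ℝ) ^ 2) ^ (K - 1) *
        (φ ^ (8 * L * (20 * H + 1) + 3 + 10 * H * L)) ^ (L - 1)) ^ (K * L) := by
          rw [pow_add φ _ (10 * H * L)]
          generalize φ ^ (8 * L * (20 * H + 1) + 3) = E1
          generalize φ ^ (10 * H * L) = E2
          generalize K - 1 = k
          generalize L - 1 = l
          generalize K * L = N
          simp only [mul_pow]
          ring
      _ ≤ _ := by
          rw [pow_mul φ]
          gcongr
          exact hφ1.le
  have hlt := natCast_pow_lt_pow_of_interpolation hH hL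
  rw [← hK] at hlt
  exact absurd hfin (not_le.2 (pow_lt_pow_left₀ hlt (by positivity) (by positivity)))

theorem abs_sub_le_mul_abs_log_sub_log {u v M : ℝ} (hu : 0 < u) (hv : 0 < v) (huM : u ≤ M)
    (hvM : v ≤ M) : |u - v| ≤ M * |log u - log v| := by
  wlog h : v ≤ u generalizing u v
  · rw [abs_sub_comm, abs_sub_comm (log u)]
    exact this hv hu hvM huM (not_le.1 h).le
  have hlog := Real.log_le_log hv h
  rw [abs_of_nonneg (by linarith), abs_of_nonneg (by linarith)]
  have h1 := Real.log_le_sub_one_of_pos (div_pos hv hu)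
  rw [Real.log_div hv.ne' hu.ne'] at h1
  have h2 : u - v = u * (1 - v / u) := by field_simp
  rw [h2]
  nlinarith

theorem natCast_ne_goldenRatio_pow {a r : ℕ} (ha : 2 ≤ a) : (a : ℝ) ≠ φ ^ r := by
  rcases r with _ | r
  · simp; omega
  · rw [← goldenRatio_mul_fib_succ_add_fib]
    have hr : Nat.fib (r + 1) ≠ 0 := (Nat.fib_pos.2 r.succ_pos).ne'
    have := (goldenRatio_irrational.mul_natCast hr).add_natCast (Nat.fib r)
    exact (this.ne_nat a).symm

theorem lt_abs_linear_form_of_lt {b H L x r : ℕ} (hb : 2 ≤ b) (hH : 4 ≤ H) (hL : 12 ≤ L)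
    (hbH : (b : ℝ) ≤ φ ^ H) (hx0 : 0 < x) (hx : x < 10 * L) (hr : r ≤ H * x) :
    (1 / 8 : ℝ) ^ (100 * H * L * L) < |x * log b - r * log φ| := by
  have hφ := goldenRatio_pos
  have hφ1 := one_lt_goldenRatio
  have hb0 : (0 : ℝ) < b := by exact_mod_cast (by omega : 0 < b)
  have hP1 : aeval φ (C ((b : ℤ) ^ x) - X ^ r : ℤ[X]) = (b : ℝ) ^ x - φ ^ r := by simp
  have hP2 : aeval ψ (C ((b : ℤ) ^ x) - X ^ r : ℤ[X]) = (b : ℝ) ^ x - ψ ^ r := by simp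
  have hne : (b : ℝ) ^ x - φ ^ r ≠ 0 := by
    have h2 : 2 ≤ b ^ x := hb.trans (Nat.le_self_pow hx0.ne' b)
    have := natCast_ne_goldenRatio_pow (r := r) h2
    push_cast at this
    exact sub_ne_zero.2 this
  have hone := one_le_abs_eval_mul_abs_eval (C ((b : ℤ) ^ x) - X ^ r : ℤ[X]) (by rwa [hP1])
  rw [hP1, hP2] at hone
  set M : ℝ := φ ^ (H * x) with hM
  have hM1 : 1 ≤ M := one_le_pow₀ hφ1.le
  have hbM : (b : ℝ) ^ x ≤ M := by
    rw [hM, pow_mul]; gcongr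
  have hrM : φ ^ r ≤ M := pow_le_pow_right₀ hφ1.le hr
  have h1 : |(b : ℝ) ^ x - ψ ^ r| ≤ 2 * M := by
    have h2 : |ψ ^ r| ≤ 1 := by
      rw [abs_pow]
      refine pow_le_one₀ (abs_nonneg _) (abs_le.2 ⟨neg_one_lt_goldenConj.le, ?_⟩)
      exact goldenConj_neg.le.trans zero_le_one
    have h3 : 0 < (b : ℝ) ^ x := by positivity
    rw [abs_le] at h2 ⊢
    constructor <;> linarith
  have h2 := abs_sub_le_mul_abs_log_sub_log (pow_pos hb0 x) (pow_pos hφ r) hbM hrM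
  rw [Real.log_pow, Real.log_pow] at h2
  set Λ : ℝ := |x * log b - r * log φ|
  have hΛ0 : 0 ≤ Λ := abs_nonneg _
  have h3 : 1 ≤ 2 * M * M * Λ := by
    refine hone.trans ((mul_le_mul h2 h1 (abs_nonneg _) (by positivity)).trans (le_of_eq ?_))
    ring
  by_contra! h4
  have h5 : 2 * M * M < 8 ^ (100 * H * L * L) := by
    have h6 : M ≤ 2 ^ (H * x) :=
      pow_le_pow_left₀ hφ.le goldenRatio_lt_two.le _
    calc 2 * M * M ≤ 2 * 2 ^ (H * x) * 2 ^ (H * x) := by gcongr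
      _ = 2 ^ (2 * (H * x) + 1) := by ring
      _ < 2 ^ (3 * (100 * H * L * L)) := by
        apply pow_lt_pow_right₀ (by norm_num)
        have : H * x ≤ H * (10 * L) := Nat.mul_le_mul_left _ hx.le
        have : H * L * 12 ≤ H * L * L := Nat.mul_le_mul_left _ hL
        nlinarith [Nat.mul_le_mul hH hL]
      _ = _ := by rw [pow_mul]; norm_num
  have h7 : 2 * M * M * Λ < 8 ^ (100 * H * L * L) * (1 / 8) ^ (100 * H * L * L) :=
    mul_lt_mul h5 h4 (lt_of_le_of_ne hΛ0 fun h => by rw [← h] at h3; norm_num at h3)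
      (by positivity)
  rw [← mul_pow] at h7
  norm_num at h7
  linarith

/-- An explicit lower bound for a linear form in the logarithms of an integer and the golden
ratio. -/
theorem lt_abs_linear_form {b H L x r : ℕ} (hb : 2 ≤ b) (hH : 4 ≤ H) (hL : 12 ≤ L)
    (hbH : (b : ℝ) ≤ φ ^ H) (hx0 : 0 < x) (hr : r ≤ H * x)
    (hB : (x * L * (20 * H + 1)) ^ 2 ≤ 3 ^ L) :
    (1 / 8 : ℝ) ^ (100 * H * L * L) < |x * log b - r * log φ| := by
  obtain ⟨d, r', x', hd0, hcop, rfl, rfl⟩ := Nat.exists_coprime' (Nat.gcd_pos_of_pos_right r hx0)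
  have hx' : 0 < x' := Nat.pos_of_mul_pos_right hx0
  have hr' : r' ≤ H * x' := by
    rw [← mul_assoc] at hr
    exact Nat.le_of_mul_le_mul_right hr hd0
  have hxx : x' ≤ x' * d := Nat.le_mul_of_pos_right _ hd0
  have hB' : (x' * L * (20 * H + 1)) ^ 2 ≤ 3 ^ L := le_trans (by gcongr) hB
  have hle : |x' * log b - r' * log φ| ≤
      |((x' * d : ℕ) : ℝ) * log b - ((r' * d : ℕ) : ℝ) * log φ| := by
    have : ((x' * d : ℕ) : ℝ) * log b - ((r' * d : ℕ) : ℝ) * log φ =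
        d * (x' * log b - r' * log φ) := by push_cast; ring
    rw [this, abs_mul, Nat.abs_cast]
    exact le_mul_of_one_le_left (abs_nonneg _) (by exact_mod_cast hd0)
  refine lt_of_lt_of_le ?_ hle
  rcases lt_or_ge x' (10 * L) with h | h
  · exact lt_abs_linear_form_of_lt hb hH hL hbH hx' h hr'
  · exact lt_abs_linear_form_of_coprime hb hH hL hbH h hr' hcop hB'

theorem lucas_add_two (n : ℕ) : lucas (n + 2) = lucas (n + 1) + lucas n := rfl

theorem lucas_succ_eq_fib_add_fib (n : ℕ) : lucas (n + 1) = Nat.fib n + Nat.fib (n + 2) := by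
  induction n using Nat.twoStepInduction with
  | zero => rfl
  | one => rfl
  | more n h1 h2 =>
    rw [lucas_add_two, h1, h2, Nat.fib_add_two (n := n + 2), Nat.fib_add_two (n := n)]
    ring_nf

theorem coe_lucas_eq (n : ℕ) : (lucas n : ℝ) = φ ^ n + ψ ^ n := by
  induction n using Nat.twoStepInduction with
  | zero => norm_num [lucas]
  | one => simp [lucas]
  | more n h1 h2 =>
    rw [lucas_add_two, Nat.cast_add, h1, h2]
    linear_combination -φ ^ n * goldenRatio_sq - ψ ^ n * goldenConj_sq

theorem lucas_pos (n : ℕ) : 0 < lucas n := by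
  cases n with
  | zero => norm_num [lucas]
  | succ n => rw [lucas_succ_eq_fib_add_fib]; exact Nat.add_pos_right _ (Nat.fib_pos.2 (by omega))

theorem lucas_succ_strictMono : StrictMono fun n => lucas (n + 1) :=
  strictMono_nat_of_lt_succ fun n => by
    have := lucas_pos n
    change lucas (n + 1) < lucas (n + 2)
    rw [lucas_add_two]; omega

theorem lucas_lt_lucas {i j : ℕ} (hi : 1 ≤ i) (hij : i < j) : lucas i < lucas j := by
  obtain ⟨i, rfl⟩ := Nat.exists_eq_add_of_le' hi
  obtain ⟨j, rfl⟩ := Nat.exists_eq_add_of_le' (hi.trans hij.le)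
  exact lucas_succ_strictMono (by omega)

theorem lucas_add_add_one (a k : ℕ) :
    lucas (a + 1 + k) = Nat.fib (k + 1) * lucas (a + 1) + Nat.fib k * lucas a := by
  induction k using Nat.twoStepInduction with
  | zero => simp
  | one => simp [lucas_add_two]
  | more k h1 h2 =>
    have : a + 1 + (k + 2) = a + 1 + k + 2 := by ring
    rw [this, lucas_add_two, show a + 1 + k + 1 = a + 1 + (k + 1) by ring, h1, h2,
      Nat.fib_add_two (n := k + 1), Nat.fib_add_two (n := k)]
    ring

theorem lucas_mod_add {M T : ℕ} (h0 : lucas T % M = 2 % M) (h1 : lucas (T + 1) % M = 1 % M)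
    (r : ℕ) : lucas (r + T) % M = lucas r % M := by
  induction r using Nat.twoStepInduction with
  | zero => simpa [lucas] using h0
  | one => rw [add_comm]; simpa [lucas] using h1
  | more r ih1 ih2 =>
    rw [show r + 2 + T = r + T + 2 by ring, lucas_add_two, lucas_add_two, Nat.add_mod,
      show r + T + 1 = r + 1 + T by ring, ih1, ih2, ← Nat.add_mod]

theorem lucas_mod_mod {M T : ℕ} (h0 : lucas T % M = 2 % M) (h1 : lucas (T + 1) % M = 1 % M)
    (r : ℕ) : lucas r % M = lucas (r % T) % M := by
  have key : ∀ s j, lucas (j + T * s) % M = lucas j % M := fun s j => by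
    induction s with
    | zero => simp
    | succ s ih => rw [mul_add, mul_one, ← add_assoc, lucas_mod_add h0 h1, ih]
  conv_lhs => rw [← Nat.mod_add_div r T]
  exact key _ _

theorem not_fib_dvd_lucas {k : ℕ} (hk : 5 ≤ k) (r : ℕ) : ¬ Nat.fib k ∣ lucas r := by
  obtain ⟨k, rfl⟩ := Nat.exists_eq_add_of_le' hk
  have h5 : 5 ≤ Nat.fib (k + 5) := Nat.fib_mono (show 5 ≤ k + 5 by omega)
  have hcop : Nat.Coprime (Nat.fib (k + 5)) (Nat.fib (k + 5 + 1)) := Nat.fib_coprime_fib_succ _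
  induction r using Nat.strong_induction_on with
  | _ r ih =>
    intro hdvd
    rcases lt_or_ge r (k + 4) with h | h
    · refine absurd (Nat.le_of_dvd (lucas_pos r) hdvd) (not_le.2 ?_)
      rcases Nat.eq_zero_or_pos r with rfl | hr
      · simp only [lucas]; omega
      · have h1 : lucas r ≤ lucas (k + 3) := by
          rcases Nat.lt_or_eq_of_le (show r ≤ k + 3 by omega) with h2 | h2
          · exact (lucas_lt_lucas hr h2).le
          · rw [h2]
        rw [lucas_succ_eq_fib_add_fib] at h1
        have h2 : Nat.fib (k + 2) < Nat.fib (k + 3) := Nat.fib_lt_fib_succ (by omega)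
        have h3 := Nat.fib_add_two (n := k + 3)
        have h4 : k + 3 + 2 = k + 5 := rfl
        have h5 : k + 2 + 2 = k + 3 + 1 := rfl
        rw [h4] at h3
        rw [h5] at h1
        omega
    rcases Nat.lt_or_eq_of_le h with h | rfl
    · rcases Nat.lt_or_eq_of_le (show k + 5 ≤ r from h) with h | h
      · obtain ⟨a, rfl⟩ := Nat.exists_eq_add_of_lt h
        rw [show k + 5 + a + 1 = a + 1 + (k + 5) by ring, lucas_add_add_one] at hdvd
        have := (Nat.dvd_add_left (Dvd.intro _ rfl)).1 hdvd
        exact ih (a + 1) (by omega) (hcop.dvd_of_dvd_mul_left this)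
      · rw [← h, lucas_succ_eq_fib_add_fib] at hdvd
        have h1 : Nat.fib (k + 4) + Nat.fib (k + 4 + 2) + Nat.fib (k + 5) =
            2 * Nat.fib (k + 5 + 1) := by
          have := Nat.fib_add_two (n := k + 4)
          have h2 : k + 4 + 2 = k + 5 + 1 := rfl
          have h3 : k + 4 + 1 = k + 5 := rfl
          rw [h3, h2] at this
          rw [h2]; omega
        have h2 := Nat.dvd_add hdvd (dvd_refl (Nat.fib (k + 5)))
        rw [h1] at h2
        have := Nat.le_of_dvd (by norm_num) (hcop.dvd_of_dvd_mul_right h2)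
        omega
    · rw [lucas_succ_eq_fib_add_fib] at hdvd
      have h1 := (Nat.dvd_add_left (dvd_refl _)).1 hdvd
      have h2 := Nat.le_of_dvd (Nat.fib_pos.2 (by omega)) h1
      have h3 : Nat.fib (k + 3) < Nat.fib (k + 4) := Nat.fib_lt_fib_succ (by omega)
      have h4 : Nat.fib (k + 4) < Nat.fib (k + 5) := Nat.fib_lt_fib_succ (by omega)
      omega

end

/-- `P` holds at the first `k` terms of the Fibonacci-type sequence starting with `u`, `v`. -/
def allFibonacciType (P : ℕ → Bool) : ℕ → ℕ → ℕ → Bool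
  | 0, _, _ => true
  | k + 1, u, v => P u && allFibonacciType P k v (u + v)

theorem apply_lucas_of_allFibonacciType {P : ℕ → Bool} {k : ℕ}
    (h : allFibonacciType P k 2 1 = true) {j : ℕ} (hj : j < k) : P (lucas j) = true := by
  have key : ∀ k s, allFibonacciType P k (lucas s) (lucas (s + 1)) = true →
      ∀ j < k, P (lucas (s + j)) = true := by
    intro k
    induction k with
    | zero => intro s _ j hj; omega
    | succ k ih =>
      intro s h j hj
      rw [allFibonacciType, Bool.and_eq_true, add_comm (lucas s), ← lucas_add_two] at h
      cases j with
      | zero => exact h.1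
      | succ j =>
        rw [← add_assoc, add_right_comm]
        exact ih (s + 1) h.2 j (by omega)
  simpa using key k 0 h j hj

/-- The moduli `S` and the period `T` exclude all solutions of `a ^ x = b ^ x + L_r` with
`x₀ ≤ x`. -/
def residueObstruction (a b x₀ T : ℕ) (S : List ℕ) : Bool :=
  (0 < T) && (S.all fun M => (a ^ (x₀ + T) % M == a ^ x₀ % M) && (b ^ (x₀ + T) % M == b ^ x₀ % M) &&
      (lucas T % M == 2 % M) && (lucas (T + 1) % M == 1 % M)) &&
    (List.range T).all fun i => allFibonacciType
      (fun u => S.any fun M => a ^ (x₀ + i) % M != (b ^ (x₀ + i) + u) % M) T 2 1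

theorem pow_mod_eq_of_period {a M x₀ T : ℕ} (h : a ^ (x₀ + T) % M = a ^ x₀ % M) (i s : ℕ) :
    a ^ (x₀ + (i + T * s)) % M = a ^ (x₀ + i) % M := by
  induction s with
  | zero => simp
  | succ s ih =>
    rw [show x₀ + (i + T * (s + 1)) = x₀ + T + (i + T * s) by ring, pow_add, Nat.mul_mod, h,
      ← Nat.mul_mod, ← pow_add, ih]

theorem pow_ne_pow_add_lucas_of_residueObstruction {a b x₀ T : ℕ} {S : List ℕ}
    (h : residueObstruction a b x₀ T S = true) {x : ℕ} (hx : x₀ ≤ x) (r : ℕ) :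
    a ^ x ≠ b ^ x + lucas r := by
  intro heq
  obtain ⟨y, rfl⟩ := Nat.exists_eq_add_of_le hx
  simp only [residueObstruction, Bool.and_eq_true, decide_eq_true_eq, List.all_eq_true,
    beq_iff_eq, List.mem_range] at h
  obtain ⟨⟨hT, hS⟩, hall⟩ := h
  have h1 := apply_lucas_of_allFibonacciType (hall (y % T) (Nat.mod_lt _ hT)) (Nat.mod_lt r hT)
  simp only [List.any_eq_true, bne_iff_ne] at h1
  obtain ⟨M, hM, hne⟩ := h1
  obtain ⟨⟨⟨ha, hb⟩, hl0⟩, hl1⟩ := hS M hM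
  have hy := Nat.mod_add_div y T
  have ha' := pow_mod_eq_of_period ha (y % T) (y / T)
  have hb' := pow_mod_eq_of_period hb (y % T) (y / T)
  rw [hy] at ha' hb'
  apply hne
  rw [← ha', heq, Nat.add_mod, hb', lucas_mod_mod hl0 hl1 r, ← Nat.add_mod]

theorem lt_of_lucas_lt {r k : ℕ} (hk : 1 ≤ k) (h : lucas r < lucas k) : r < k := by
  by_contra! hkr
  rcases hkr.eq_or_lt with rfl | hlt
  · exact lt_irrefl _ h
  · exact absurd (lucas_lt_lucas hk hlt) (not_lt.2 h.le)

theorem lucas_eq_of_lt_eighteen {r c : ℕ} (hc : c < 18) (h : c = lucas r) :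
    (r = 0 ∧ c = 2) ∨ (r = 1 ∧ c = 1) ∨ (r = 2 ∧ c = 3) ∨ (r = 3 ∧ c = 4) ∨ (r = 4 ∧ c = 7) ∨
      (r = 5 ∧ c = 11) := by
  have hr : r < 6 := lt_of_lucas_lt (by norm_num) (by rw [← h]; exact hc)
  interval_cases r <;> simp_all [lucas]

theorem fib_pow_eq_lucas {n r x : ℕ} (hx : 0 < x) (h : Nat.fib n ^ x = lucas r) :
    (n = 1 ∧ r = 1) ∨ (n = 2 ∧ r = 1) ∨ (n = 3 ∧ r = 3 ∧ x = 2) ∨ (n = 3 ∧ r = 0 ∧ x = 1) ∨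
      (n = 4 ∧ r = 2 ∧ x = 1) := by
  rcases le_or_gt 5 n with h5 | h5
  · exact absurd (h ▸ dvd_pow_self _ hx.ne') (not_fib_dvd_lucas h5 r)
  interval_cases n
  · rw [Nat.fib_zero, zero_pow hx.ne'] at h
    exact absurd h (lucas_pos r).ne
  · have := lucas_eq_of_lt_eighteen (c := 1) (by norm_num) (by simpa using h)
    omega
  · have := lucas_eq_of_lt_eighteen (c := 1) (by norm_num) (by simpa using h)
    omega
  · change 2 ^ x = _ at h
    have hx3 : x < 3 := by
      by_contra! hx3
      refine pow_ne_pow_add_lucas_of_residueObstruction (a := 2) (b := 0) (x₀ := 3) (T := 12)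
        (S := [8]) (by decide +kernel) hx3 r ?_
      rw [h, zero_pow hx.ne', zero_add]
    interval_cases x <;> have := lucas_eq_of_lt_eighteen (by norm_num) h <;> omega
  · change 3 ^ x = _ at h
    have hx3 : x < 2 := by
      by_contra! hx3
      refine pow_ne_pow_add_lucas_of_residueObstruction (a := 3) (b := 0) (x₀ := 2) (T := 24)
        (S := [9, 2]) (by decide +kernel) hx3 r ?_
      rw [h, zero_pow hx.ne', zero_add]
    interval_cases x
    have := lucas_eq_of_lt_eighteen (by norm_num) h
    omega

theorem lt_five_of_fib_dvd_lucas {k r : ℕ} (h : Nat.fib k ∣ lucas r) : k < 5 := by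
  by_contra! hk
  exact not_fib_dvd_lucas hk r h

set_option synthInstance.maxHeartbeats 400000 in
set_option synthInstance.maxSize 1000 in
theorem fib_sub_fib_eq_lucas_of_lt_seven : ∀ n < 7, ∀ m < n, ∀ r < 6, m ≠ 0 →
    Nat.fib n = Nat.fib m + lucas r →
      (n, m, r) ∈ ({(3, 1, 1), (3, 2, 1), (4, 1, 0), (4, 2, 0), (5, 4, 0), (4, 3, 1), (5, 2, 3),
        (6, 5, 2), (6, 1, 4), (5, 3, 2)} : Finset (ℕ × ℕ × ℕ)) ∨ n = m + 4 ∧ r = m + 2 := by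
  decide

theorem solutions_of_exponent_one {n m r : ℕ} (hm : m ≠ 0)
    (h : Nat.fib n = Nat.fib m + lucas r) :
    (n, m, r) ∈ ({(3, 1, 1), (3, 2, 1), (4, 1, 0), (4, 2, 0), (5, 4, 0), (4, 3, 1), (5, 2, 3),
      (6, 5, 2), (6, 1, 4), (5, 3, 2)} : Set (ℕ × ℕ × ℕ)) ∨
      ∃ k, 4 ≤ k ∧ (n, m, r) = (k + 1, k - 3, k - 1) := by
  have hr := lucas_pos r
  have hmn : m < n := by
    by_contra! hle
    have := Nat.fib_mono hle
    omega
  rcases lt_or_ge n 7 with hn | hn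
  · have hr6 : r < 6 := lt_of_lucas_lt (by norm_num) <| by
      have h1 := Nat.fib_mono (show n ≤ 6 by omega)
      have h2 : Nat.fib 6 = 8 := rfl
      have h3 : lucas 6 = 18 := rfl
      omega
    rcases fib_sub_fib_eq_lucas_of_lt_seven n hn m hmn r hr6 hm h with h1 | ⟨rfl, rfl⟩
    · left
      simpa only [Set.mem_insert_iff, Set.mem_singleton_iff, Finset.mem_insert,
        Finset.mem_singleton] using h1
    · exact Or.inr ⟨m + 3, by omega, by simp⟩
  right
  obtain ⟨d, rfl⟩ := Nat.exists_eq_add_of_lt hmn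
  have e1 := Nat.fib_add_two (n := m)
  have e2 := Nat.fib_add_two (n := m + 1)
  have e3 := Nat.fib_add_two (n := m + 2)
  simp only [add_assoc, Nat.reduceAdd] at e1 e2 e3 h hn
  rcases lt_or_ge d 4 with hd | hd
  · interval_cases d
    · obtain ⟨m, rfl⟩ := Nat.exists_eq_succ_of_ne_zero hm
      have e0 := Nat.fib_add_two (n := m)
      have hr : lucas r = Nat.fib m := by
        simp only [Nat.succ_eq_add_one, add_assoc, Nat.reduceAdd, zero_add] at h; omega
      have := lt_five_of_fib_dvd_lucas (k := m) (r := r) (hr ▸ dvd_rfl)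
      omega
    · have := lt_five_of_fib_dvd_lucas (k := m + 1) (r := r) (by
        rw [show lucas r = Nat.fib (m + 1) by simp only [Nat.reduceAdd] at h; omega])
      omega
    · have := lt_five_of_fib_dvd_lucas (k := m + 1) (r := r) (by
        rw [show lucas r = Nat.fib (m + 1) * 2 by simp only [Nat.reduceAdd] at h; omega]
        exact Dvd.intro _ rfl)
      omega
    · have hr : lucas r = lucas (m + 2) := by
        rw [lucas_succ_eq_fib_add_fib, add_assoc]; simp only [Nat.reduceAdd] at h ⊢; omega
      have h1 : ¬ m + 2 < r := fun hlt => (lucas_lt_lucas (by omega) hlt).ne' hr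
      have h2 : ¬ r < m + 2 := fun hlt => by
        have h3 : lucas 2 < lucas (m + 2) := lucas_lt_lucas (by norm_num) (by omega)
        rcases Nat.eq_zero_or_pos r with rfl | h0
        · simp only [lucas] at hr h3; omega
        · exact (lucas_lt_lucas h0 hlt).ne hr
      exact ⟨m + 3, by omega, by rw [show r = m + 2 by omega]; simp⟩
  · exfalso
    obtain ⟨e, rfl⟩ := Nat.exists_eq_add_of_le' hd
    have f1 := Nat.fib_add_two (n := m + (e + 3))
    have f2 := Nat.fib_add_two (n := m + (e + 2))
    have f3 := Nat.fib_add_two (n := m + (e + 1))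
    have l1 := lucas_succ_eq_fib_add_fib (m + (e + 2))
    have l2 := lucas_succ_eq_fib_add_fib (m + (e + 3))
    simp only [add_assoc, Nat.reduceAdd] at f1 f2 f3 l1 l2 h
    have hlt : Nat.fib m < Nat.fib (m + (e + 1)) := by
      rcases Nat.eq_zero_or_pos e with rfl | he
      · simpa using Nat.fib_lt_fib_succ (by omega)
      · exact (Nat.fib_mono (by omega)).trans_lt (Nat.fib_lt_fib_succ (n := m + e) (by omega))
    have hm0 : 0 < Nat.fib m := Nat.fib_pos.2 (by omega)
    have h3 := lt_of_lucas_lt (r := r) (k := m + (e + 4)) (by omega) (by omega)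
    have h4 := lt_of_lucas_lt (r := m + (e + 3)) (k := r) (by
      rcases Nat.eq_zero_or_pos r with rfl | h0
      · have h2 := Nat.fib_mono (show 3 ≤ m + (e + 2) by omega)
        have h8 : Nat.fib 3 = 2 := rfl
        simp only [lucas] at h
        omega
      · exact h0) (by omega)
    omega

theorem fib_sub_fib_dvd_lucas {n m r x : ℕ}
    (h : Nat.fib n ^ x = Nat.fib m ^ x + lucas r) : Nat.fib n - Nat.fib m ∣ lucas r := by
  have h1 := Nat.sub_dvd_pow_sub_pow (Nat.fib n) (Nat.fib m) x
  rwa [h, Nat.add_sub_cancel_left] at h1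

theorem two_pow_eq_one_add_lucas {x r : ℕ} (hx : 2 ≤ x) (h : 2 ^ x = 1 ^ x + lucas r) :
    (r = 2 ∧ x = 2) ∨ (r = 4 ∧ x = 3) := by
  have hx4 : x < 4 := by
    by_contra! hx4
    exact pow_ne_pow_add_lucas_of_residueObstruction (T := 24) (S := [3, 4, 5, 8, 9, 16])
      (by decide +kernel) hx4 r h
  interval_cases x
  · have := lucas_eq_of_lt_eighteen (c := 3) (r := r) (by norm_num) (by omega)
    omega
  · have := lucas_eq_of_lt_eighteen (c := 7) (r := r) (by norm_num) (by omega)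
    omega

theorem solutions_of_close_indices {n m r x : ℕ} (hx : 2 ≤ x) (hm : m ≠ 0) (hmn : m < n)
    (hn : n ≤ m + 3) (h : Nat.fib n ^ x = Nat.fib m ^ x + lucas r) :
    (n, m, r, x) ∈ ({(3, 1, 2, 2), (3, 2, 2, 2), (3, 1, 4, 3), (3, 2, 4, 3)} :
      Set (ℕ × ℕ × ℕ × ℕ)) := by
  have hdvd := fib_sub_fib_dvd_lucas h
  have hm5 : m ≤ 5 ∧ (m + 2 ≤ n → m ≤ 3) := by
    obtain ⟨m, rfl⟩ := Nat.exists_eq_succ_of_ne_zero hm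
    have e0 := Nat.fib_add_two (n := m)
    have e1 := Nat.fib_add_two (n := m + 1)
    have e2 := Nat.fib_add_two (n := m + 2)
    simp only [Nat.succ_eq_add_one, add_assoc, Nat.reduceAdd] at *
    obtain rfl | rfl | rfl : n = m + 2 ∨ n = m + 3 ∨ n = m + 4 := by omega
    · rw [show Nat.fib (m + 2) - Nat.fib (m + 1) = Nat.fib m by omega] at hdvd
      have := lt_five_of_fib_dvd_lucas hdvd
      omega
    · rw [show Nat.fib (m + 3) - Nat.fib (m + 1) = Nat.fib (m + 2) by omega] at hdvd
      have := lt_five_of_fib_dvd_lucas hdvd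
      omega
    · rw [show Nat.fib (m + 4) - Nat.fib (m + 1) = Nat.fib (m + 2) * 2 by omega] at hdvd
      have := lt_five_of_fib_dvd_lucas (dvd_of_mul_right_dvd hdvd)
      omega
  have no : ∀ {a b : ℕ} (T : ℕ) (S : List ℕ) (x₀ : ℕ), residueObstruction a b x₀ T S = true →
      x₀ ≤ 2 → a ^ x = b ^ x + lucas r → False := fun T S x₀ h1 h2 h3 =>
    pow_ne_pow_add_lucas_of_residueObstruction h1 (h2.trans hx) r h3
  obtain ⟨hm5, hm3⟩ := hm5
  have key : (n = 3 ∧ (m = 1 ∨ m = 2)) := by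
    by_contra hne
    have hm1 := Nat.pos_of_ne_zero hm
    interval_cases m
    · obtain rfl | rfl | rfl : n = 2 ∨ n = 3 ∨ n = 4 := by omega
      · exact (lucas_pos r).ne' (by simpa using h)
      · omega
      · exact no 24 [3, 4, 5, 9] 2 (by decide +kernel) le_rfl h
    · obtain rfl | rfl | rfl : n = 3 ∨ n = 4 ∨ n = 5 := by omega
      · omega
      · exact no 24 [3, 4, 5, 9] 2 (by decide +kernel) le_rfl h
      · exact no 60 [4, 5, 8, 11, 25] 2 (by decide +kernel) le_rfl h
    · obtain rfl | rfl | rfl : n = 4 ∨ n = 5 ∨ n = 6 := by omega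
      · exact no 60 [4, 5, 11, 31, 61] 2 (by decide +kernel) le_rfl h
      · exact no 24 [3, 4] 2 (by decide +kernel) le_rfl h
      · exact no 24 [3, 5] 1 (by decide +kernel) (by norm_num) h
    · obtain rfl : n = 5 := by omega
      exact no 72 [3, 4, 5, 8, 9, 19] 2 (by decide +kernel) le_rfl h
    · obtain rfl : n = 6 := by omega
      exact no 48 [3, 4, 5, 7, 9, 16] 2 (by decide +kernel) le_rfl h
  obtain ⟨rfl, rfl | rfl⟩ := key <;>
    rcases two_pow_eq_one_add_lucas hx h with ⟨rfl, rfl⟩ | ⟨rfl, rfl⟩ <;>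
    simp

section

open Real goldenRatio
open scoped goldenRatio

/-- The Taylor polynomial of the inverse hyperbolic tangent with `N` terms. -/
def artanhTaylor (N : ℕ) (x : ℚ) : ℚ := ∑ i ∈ Finset.range N, x ^ (2 * i + 1) / (2 * i + 1)

theorem artanhTaylor_le_half_log {x : ℚ} (h0 : 0 ≤ x) (h1 : x < 1) (N : ℕ) :
    (artanhTaylor N x : ℝ) ≤ 1 / 2 * log ((1 + x) / (1 - x)) := by
  have := sum_range_le_log_div (x := (x : ℝ)) (by exact_mod_cast h0) (by exact_mod_cast h1) N
  simpa [artanhTaylor] using this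

theorem half_log_le_artanhTaylor_add {x : ℚ} (h0 : 0 ≤ x) (h1 : x < 1) (N : ℕ) :
    1 / 2 * log ((1 + x) / (1 - x)) ≤
      ((artanhTaylor N x + x ^ (2 * N + 1) / (1 - x ^ 2) : ℚ) : ℝ) := by
  have := log_div_le_sum_range_add (x := (x : ℝ)) (by exact_mod_cast h0) (by exact_mod_cast h1) N
  simpa [artanhTaylor] using this

/-- A rational lower bound for `√5`. -/
def sqrtFiveLower : ℚ := 2236067977499789696409173668731276235440618359 / 10 ^ 45
/-- A rational upper bound for `√5`. -/
def sqrtFiveUpper : ℚ := 2236067977499789696409173668731276235440618360 / 10 ^ 45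
/-- A rational lower bound for `log 5`. -/
def logFiveLower : ℚ := 16094379124341003746007593332261876395256 / 10 ^ 40
/-- A rational upper bound for `log 5`. -/
def logFiveUpper : ℚ := 16094379124341003746007593332261876395257 / 10 ^ 40
/-- A rational lower bound for `log φ`. -/
def logGoldenLower : ℚ := 4812118250596034474977589134243684231351 / 10 ^ 40
/-- A rational upper bound for `log φ`. -/
def logGoldenUpper : ℚ := 4812118250596034474977589134243684231352 / 10 ^ 40

theorem sqrtFiveLower_le : (sqrtFiveLower : ℝ) ≤ √5 := by
  refine Real.le_sqrt_of_sq_le ?_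
  have : sqrtFiveLower ^ 2 ≤ 5 := by decide +kernel
  exact_mod_cast this

theorem le_sqrtFiveUpper : √5 ≤ (sqrtFiveUpper : ℝ) := by
  rw [Real.sqrt_le_left (by exact_mod_cast (by decide +kernel : 0 ≤ sqrtFiveUpper))]
  have : 5 ≤ sqrtFiveUpper ^ 2 := by decide +kernel
  exact_mod_cast this

theorem log_five_eq :
    log 5 = 2 * (1 / 2 * log ((1 + (1 / 9 : ℚ)) / (1 - (1 / 9 : ℚ)))) +
      4 * (1 / 2 * log ((1 + (1 / 3 : ℚ)) / (1 - (1 / 3 : ℚ)))) := by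
  push_cast
  rw [show (1 + 1 / 9 : ℝ) / (1 - 1 / 9) = 5 / 2 ^ 2 by norm_num,
    show (1 + 1 / 3 : ℝ) / (1 - 1 / 3) = 2 by norm_num, Real.log_div (by norm_num) (by norm_num),
    Real.log_pow]
  push_cast
  ring

theorem logFiveLower_le : (logFiveLower : ℝ) ≤ log 5 := by
  rw [log_five_eq]
  have h1 := artanhTaylor_le_half_log (x := 1 / 9) (by norm_num) (by norm_num) 45
  have h2 := artanhTaylor_le_half_log (x := 1 / 3) (by norm_num) (by norm_num) 45
  have h3 : logFiveLower ≤ 2 * artanhTaylor 45 (1 / 9) + 4 * artanhTaylor 45 (1 / 3) := by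
    decide +kernel
  have h4 : (logFiveLower : ℝ) ≤ 2 * artanhTaylor 45 (1 / 9) + 4 * artanhTaylor 45 (1 / 3) := by
    exact_mod_cast h3
  linarith

theorem le_logFiveUpper : log 5 ≤ (logFiveUpper : ℝ) := by
  rw [log_five_eq]
  have h1 := half_log_le_artanhTaylor_add (x := 1 / 9) (by norm_num) (by norm_num) 45
  have h2 := half_log_le_artanhTaylor_add (x := 1 / 3) (by norm_num) (by norm_num) 45
  have h3 : 2 * (artanhTaylor 45 (1 / 9) + (1 / 9) ^ (2 * 45 + 1) / (1 - (1 / 9) ^ 2)) +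
      4 * (artanhTaylor 45 (1 / 3) + (1 / 3) ^ (2 * 45 + 1) / (1 - (1 / 3) ^ 2)) ≤
      logFiveUpper := by
    decide +kernel
  have h4 : ((2 * (artanhTaylor 45 (1 / 9) + (1 / 9) ^ (2 * 45 + 1) / (1 - (1 / 9) ^ 2)) +
      4 * (artanhTaylor 45 (1 / 3) + (1 / 3) ^ (2 * 45 + 1) / (1 - (1 / 3) ^ 2)) : ℚ) : ℝ) ≤
      logFiveUpper := by
    exact_mod_cast h3
  rw [Rat.cast_add, Rat.cast_mul, Rat.cast_mul] at h4
  linarith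

theorem log_goldenRatio_eq : log φ = 1 / 2 * log ((1 + √5 / 5) / (1 - √5 / 5)) := by
  have h5 : √5 * √5 = 5 := Real.mul_self_sqrt (by norm_num)
  have h2 : √5 < 5 := by nlinarith [Real.sqrt_nonneg 5]
  have : (1 + √5 / 5) / (1 - √5 / 5) = φ ^ 2 := by
    rw [goldenRatio_sq, goldenRatio, div_eq_iff (by linarith)]
    linear_combination (1 / 10 : ℝ) * h5
  rw [this, Real.log_pow]
  push_cast
  ring

/-- The Taylor polynomial of `log φ`, divided by `√5`. -/
def logGoldenTaylor (N : ℕ) : ℚ := ∑ i ∈ Finset.range N, (1 / 5) ^ (i + 1) / (2 * i + 1)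

theorem sqrt_five_div_five_pow (i : ℕ) : (√5 / 5) ^ (2 * i + 1) = √5 * (1 / 5) ^ (i + 1) := by
  have h5 : (√5 / 5) ^ 2 = 1 / 5 := by rw [div_pow, Real.sq_sqrt (by norm_num)]; norm_num
  rw [pow_succ, pow_mul, h5]
  ring

theorem sum_sqrt_five_div_five_pow (N : ℕ) :
    ∑ i ∈ Finset.range N, (√5 / 5) ^ (2 * i + 1) / (2 * i + 1) = √5 * logGoldenTaylor N := by
  simp only [logGoldenTaylor, Rat.cast_sum, Finset.mul_sum]
  refine Finset.sum_congr rfl fun i _ => ?_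
  rw [sqrt_five_div_five_pow]
  push_cast
  ring

theorem logGoldenLower_le : (logGoldenLower : ℝ) ≤ log φ := by
  have h5 : √5 * √5 = 5 := Real.mul_self_sqrt (by norm_num)
  have h2 : √5 < 5 := by nlinarith [Real.sqrt_nonneg 5]
  have h1 := sum_range_le_log_div (x := √5 / 5) (by positivity) (by linarith) 60
  rw [← log_goldenRatio_eq, sum_sqrt_five_div_five_pow] at h1
  have h3 : logGoldenLower ≤ sqrtFiveLower * logGoldenTaylor 60 := by decide +kernel
  have h4 : (logGoldenLower : ℝ) ≤ sqrtFiveLower * logGoldenTaylor 60 := by exact_mod_cast h3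
  have h6 : (0 : ℝ) ≤ logGoldenTaylor 60 := by
    exact_mod_cast (by decide +kernel : 0 ≤ logGoldenTaylor 60)
  exact h4.trans ((mul_le_mul_of_nonneg_right sqrtFiveLower_le h6).trans h1)

theorem le_logGoldenUpper : log φ ≤ (logGoldenUpper : ℝ) := by
  have h5 : √5 * √5 = 5 := Real.mul_self_sqrt (by norm_num)
  have h2 : √5 < 5 := by nlinarith [Real.sqrt_nonneg 5]
  have hs : (√5 / 5) ^ 2 = 1 / 5 := by rw [div_pow, Real.sq_sqrt (by norm_num)]; norm_num
  have h1 := log_div_le_sum_range_add (x := √5 / 5) (by positivity) (by linarith) 60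
  rw [← log_goldenRatio_eq, sum_sqrt_five_div_five_pow, sqrt_five_div_five_pow, hs,
    mul_div_assoc, ← mul_add] at h1
  have h3 : sqrtFiveUpper * (logGoldenTaylor 60 + (1 / 5) ^ (60 + 1) / (1 - 1 / 5)) ≤
      logGoldenUpper := by decide +kernel
  have h4 := (Rat.cast_le (K := ℝ)).2 h3
  push_cast at h4
  have h6 : (0 : ℝ) ≤ logGoldenTaylor 60 := by
    exact_mod_cast (by decide +kernel : 0 ≤ logGoldenTaylor 60)
  refine h1.trans ((mul_le_mul_of_nonneg_right le_sqrtFiveUpper ?_).trans h4)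
  norm_num
  linarith

theorem five_mul_fib_le {n m : ℕ} (hmn : m + 4 ≤ n) : 5 * Nat.fib m ≤ Nat.fib n := by
  have h1 := Nat.fib_mono hmn
  have e1 := Nat.fib_add_two (n := m)
  have e2 := Nat.fib_add_two (n := m + 1)
  have e3 := Nat.fib_add_two (n := m + 2)
  have h2 : Nat.fib m ≤ Nat.fib (m + 1) := Nat.fib_le_fib_succ
  simp only [add_assoc, Nat.reduceAdd] at *
  omega

theorem fib_succ_le_goldenRatio_pow (n : ℕ) : (Nat.fib (n + 1) : ℝ) ≤ φ ^ n := by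
  have h := goldenRatio_mul_fib_succ_add_fib n
  have hφ := goldenRatio_pos
  rw [pow_succ'] at h
  have : φ * Nat.fib (n + 1) ≤ φ * φ ^ n := by
    rw [← h]; exact le_add_of_nonneg_right (Nat.cast_nonneg _)
  exact le_of_mul_le_mul_left this hφ

theorem abs_goldenConj_pow_le_one (r : ℕ) : |ψ ^ r| ≤ 1 := by
  rw [abs_pow]
  refine pow_le_one₀ (abs_nonneg _) (abs_le.2 ⟨neg_one_lt_goldenConj.le, ?_⟩)
  exact goldenConj_neg.le.trans zero_le_one

theorem goldenRatio_pow_bounds {n m r x : ℕ} (hm : m ≠ 0)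
    (h : Nat.fib n ^ x = Nat.fib m ^ x + lucas r) :
    φ ^ r ≤ (Nat.fib n : ℝ) ^ x ∧ (Nat.fib n : ℝ) ^ x ≤ φ ^ r + 2 * (Nat.fib m : ℝ) ^ x := by
  have hF : (1 : ℝ) ≤ (Nat.fib m : ℝ) ^ x :=
    one_le_pow₀ (by exact_mod_cast Nat.fib_pos.2 (Nat.pos_of_ne_zero hm))
  have h1 : (Nat.fib n : ℝ) ^ x = (Nat.fib m : ℝ) ^ x + (φ ^ r + ψ ^ r) := by
    rw [← coe_lucas_eq]; exact_mod_cast h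
  have h2 := abs_le.1 (abs_goldenConj_pow_le_one r)
  constructor <;> linarith

theorem le_mul_of_fib_pow_eq {n m r x : ℕ} (hm : m ≠ 0)
    (h : Nat.fib (n + 1) ^ x = Nat.fib m ^ x + lucas r) : r ≤ n * x := by
  have h1 := (goldenRatio_pow_bounds hm h).1.trans
    (pow_le_pow_left₀ (Nat.cast_nonneg _) (fib_succ_le_goldenRatio_pow n) x)
  rw [← pow_mul] at h1
  exact (pow_le_pow_iff_right₀ one_lt_goldenRatio).1 h1

theorem linear_form_bounds {n m r x : ℕ} (hm : m ≠ 0) (hmn : m + 4 ≤ n) (hx : 2 ≤ x)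
    (h : Nat.fib n ^ x = Nat.fib m ^ x + lucas r) :
    0 ≤ x * log (Nat.fib n) - r * log φ ∧
      x * log (Nat.fib n) - r * log φ ≤ 11 / 5 * (1 / 5) ^ x := by
  obtain ⟨h1, h2⟩ := goldenRatio_pow_bounds hm h
  have hn : (0 : ℝ) < Nat.fib n := by exact_mod_cast Nat.fib_pos.2 (by omega)
  have hφ := goldenRatio_pos
  have hP : 0 < φ ^ r := by positivity
  have hA : 0 < (Nat.fib n : ℝ) ^ x := by positivity
  rw [← Real.log_pow, ← Real.log_pow, ← Real.log_div hA.ne' hP.ne']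
  refine ⟨Real.log_nonneg ((one_le_div hP).2 h1), ?_⟩
  refine (Real.log_le_sub_one_of_pos (by positivity)).trans ?_
  rw [div_sub_one hP.ne', div_le_iff₀ hP]
  have h3 : (Nat.fib m : ℝ) ^ x ≤ (1 / 5) ^ x * (Nat.fib n : ℝ) ^ x := by
    rw [← mul_pow]
    refine pow_le_pow_left₀ (Nat.cast_nonneg _) ?_ x
    have : (5 * Nat.fib m : ℝ) ≤ Nat.fib n := by exact_mod_cast five_mul_fib_le hmn
    linarith
  have h4 : (1 / 5 : ℝ) ^ x ≤ (1 / 5) ^ 2 := pow_le_pow_of_le_one (by norm_num) (by norm_num) hx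
  have h5 : (0 : ℝ) < (1 / 5) ^ x := by positivity
  nlinarith [mul_le_mul_of_nonneg_right h4 hA.le, mul_nonneg h5.le hA.le,
    mul_le_mul_of_nonneg_left h2 h5.le, mul_le_mul_of_nonneg_left h3 h5.le,
    mul_le_mul_of_nonneg_right h4 (mul_nonneg h5.le hA.le)]

theorem goldenConj_div_goldenRatio_pow (n : ℕ) : |(ψ / φ) ^ n| = (φ ^ (2 * n))⁻¹ := by
  rw [abs_pow, pow_mul, ← inv_pow, abs_div, abs_of_neg goldenConj_neg,
    abs_of_pos goldenRatio_pos, ← inv_goldenRatio, sq, mul_inv, div_eq_mul_inv]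

theorem log_fib_eq {n : ℕ} (hn : 0 < n) :
    log (Nat.fib n) = n * log φ - log 5 / 2 + log (1 - (ψ / φ) ^ n) := by
  have hφ : 0 < φ ^ n := pow_pos goldenRatio_pos n
  have h5 : (0 : ℝ) < √5 := by positivity
  have h1 : (Nat.fib n : ℝ) = φ ^ n / √5 * (1 - (ψ / φ) ^ n) := by
    have h0 : φ ^ n * (ψ / φ) ^ n = ψ ^ n := by
      rw [← mul_pow, mul_div_cancel₀ _ goldenRatio_ne_zero]
    rw [coe_fib_eq]
    linear_combination (1 / √5) * h0
  have h2 : (Nat.fib n : ℝ) ≠ 0 := by exact_mod_cast (Nat.fib_pos.2 hn).ne'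
  have h3 : 1 - (ψ / φ) ^ n ≠ 0 := fun h => h2 (by rw [h1, h, mul_zero])
  rw [h1, Real.log_mul (by positivity) h3, Real.log_div hφ.ne' h5.ne', Real.log_pow,
    Real.log_sqrt (by norm_num)]

theorem log_one_sub_bounds {ε : ℝ} (h : |ε| ≤ 1 / 2) :
    -(2 * |ε|) ≤ log (1 - ε) ∧ log (1 - ε) ≤ |ε| := by
  obtain ⟨h1, h2⟩ := abs_le.1 h
  have h3 := neg_abs_le ε
  have h4 := le_abs_self ε
  constructor
  · refine le_trans ?_ (Real.one_sub_inv_le_log_of_pos (by linarith : 0 < 1 - ε))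
    rw [neg_le_sub_iff_le_add, inv_le_iff_one_le_mul₀ (by linarith)]
    rcases abs_cases ε with ⟨h5, -⟩ | ⟨h5, -⟩ <;> rw [h5] <;> nlinarith
  · linarith [Real.log_le_sub_one_of_pos (by linarith : 0 < 1 - ε)]

theorem log_five_form_bounds {n m r x : ℕ} (hm : m ≠ 0) (hmn : m + 4 ≤ n) (hx : 2 ≤ x)
    (h : Nat.fib n ^ x = Nat.fib m ^ x + lucas r) :
    ∃ k ≤ 2 * x, -(4 * x * (φ ^ (2 * n))⁻¹ + 22 / 5 * (1 / 5) ^ x) ≤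
        x * log 5 - ((2 * k : ℕ) : ℝ) * log φ ∧
      x * log 5 - ((2 * k : ℕ) : ℝ) * log φ ≤ 4 * x * (φ ^ (2 * n))⁻¹ := by
  obtain ⟨h1, h2⟩ := linear_form_bounds hm hmn hx h
  have hφ := goldenRatio_pos
  have hrn : r ≤ n * x := by
    obtain ⟨n, rfl⟩ := Nat.exists_eq_add_of_le' (show 1 ≤ n by omega)
    exact (le_mul_of_fib_pow_eq hm h).trans (Nat.mul_le_mul_right _ (Nat.le_succ _))
  obtain ⟨k, hk⟩ := Nat.exists_eq_add_of_le hrn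
  have hk' : (n * x : ℝ) = r + k := by exact_mod_cast hk
  have h10 : (φ ^ (2 * n))⁻¹ ≤ 1 / 100 := by
    rw [one_div]
    refine inv_anti₀ (by norm_num) ?_
    have h3 : φ ^ 10 ≤ φ ^ (2 * n) := pow_le_pow_right₀ one_lt_goldenRatio.le (by omega)
    have h4 : φ ^ 10 = 55 * φ + 34 := by
      have := goldenRatio_mul_fib_succ_add_fib 9
      have e1 : Nat.fib 10 = 55 := by decide
      have e2 : Nat.fib 9 = 34 := by decide
      norm_num [e1, e2] at this
      linarith
    have h5 : 3 / 2 < φ := by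
      have : (2 : ℝ) < √5 := by rw [Real.lt_sqrt (by norm_num)]; norm_num
      rw [goldenRatio]; linarith
    linarith
  have hε := goldenConj_div_goldenRatio_pow n
  obtain ⟨b1, b2⟩ := log_one_sub_bounds (ε := (ψ / φ) ^ n) (by rw [hε]; linarith)
  rw [hε] at b1 b2
  rw [log_fib_eq (by omega)] at h1 h2
  set E := (φ ^ (2 * n))⁻¹
  have hE : 0 ≤ E := by positivity
  set w := log (1 - (ψ / φ) ^ n)
  have hx0 : (0 : ℝ) ≤ x := Nat.cast_nonneg x
  have c1 := mul_le_mul_of_nonneg_left b1 hx0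
  have c2 := mul_le_mul_of_nonneg_left b2 hx0
  have c3 := mul_nonneg hx0 hE
  have e1 : x * (n * log φ - log 5 / 2 + w) - r * log φ =
      k * log φ - x * log 5 / 2 + x * w := by
    linear_combination log φ * hk'
  rw [e1] at h1 h2
  have l1 : -(4 * x * E + 22 / 5 * (1 / 5) ^ x) ≤ x * log 5 - ((2 * k : ℕ) : ℝ) * log φ := by
    push_cast; linarith
  refine ⟨k, ?_, l1, by push_cast; linarith⟩
  have hl : (0.481 : ℝ) < log φ := lt_of_lt_of_le (by norm_num [logGoldenLower]) logGoldenLower_le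
  have hl5 : log 5 < (1.61 : ℝ) := lt_of_le_of_lt le_logFiveUpper (by norm_num [logFiveUpper])
  by_contra! hlt
  have hlt' : (2 * x + 1 : ℝ) ≤ k := by exact_mod_cast hlt
  have h4 : (1 / 5 : ℝ) ^ x ≤ (1 / 5) ^ 2 := pow_le_pow_of_le_one (by norm_num) (by norm_num) hx
  have hx2 : (2 : ℝ) ≤ x := by exact_mod_cast hx
  have c4 := mul_le_mul_of_nonneg_left h10 hx0
  have c5 := mul_le_mul_of_nonneg_left hl5.le hx0
  have c6 := mul_le_mul_of_nonneg_right hlt' (by linarith : 0 ≤ log φ)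
  have c7 := mul_le_mul_of_nonneg_left hl.le hx0
  push_cast at l1
  linarith

theorem three_mul_lt_of_lt_pow {M x : ℕ} {c : ℝ} (hc : c ≤ 25)
    (h : (1 / 8 : ℝ) ^ M < c * (1 / 5) ^ x) : 3 * x < 4 * M + 6 := by
  have h1 : (5 : ℝ) ^ x < 25 * 8 ^ M := by
    have h0 := h.trans_le (mul_le_mul_of_nonneg_right hc (by positivity))
    rw [one_div_pow, one_div_pow, mul_one_div, div_lt_div_iff₀ (by positivity) (by positivity)]
      at h0
    linarith
  have h2 : (5 : ℝ) ^ (3 * x) < 5 ^ (4 * M + 6) := by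
    calc (5 : ℝ) ^ (3 * x) = (5 ^ x) ^ 3 := by rw [← pow_mul, mul_comm]
      _ < (25 * 8 ^ M) ^ 3 := pow_lt_pow_left₀ h1 (by positivity) (by norm_num)
      _ = (8 ^ 3) ^ M * 5 ^ 6 := by rw [mul_pow, ← pow_mul, mul_comm M, pow_mul]; ring
      _ ≤ (5 ^ 4) ^ M * 5 ^ 6 := by gcongr; norm_num
      _ = 5 ^ (4 * M + 6) := by rw [← pow_mul, ← pow_add]
  exact (pow_lt_pow_iff_right₀ (by norm_num)).1 h2

theorem two_mul_lt_of_pow_lt {N n : ℕ} (h : φ ^ (2 * n) < 2 ^ N) : 4 * n < 3 * N := by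
  have h4 : (4 : ℝ) ≤ φ ^ 3 := by
    have := goldenRatio_sq
    have h5 : 3 / 2 < φ := by
      have : (2 : ℝ) < √5 := by rw [Real.lt_sqrt (by norm_num)]; norm_num
      rw [goldenRatio]; linarith
    have h6 : φ ^ 3 = 2 * φ + 1 := by linear_combination (φ + 1) * this
    linarith
  have h2 : φ ^ (4 * n) < φ ^ (3 * N) := by
    calc φ ^ (4 * n) = (φ ^ (2 * n)) ^ 2 := by rw [← pow_mul]; ring_nf
      _ < (2 ^ N) ^ 2 := pow_lt_pow_left₀ h (pow_nonneg goldenRatio_pos.le _) (by norm_num)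
      _ = 4 ^ N := by rw [← pow_mul, mul_comm, pow_mul]; norm_num
      _ ≤ (φ ^ 3) ^ N := by gcongr
      _ = φ ^ (3 * N) := by rw [← pow_mul]
  exact (pow_lt_pow_iff_right₀ one_lt_goldenRatio).1 h2

theorem growth_three_pow (s : ℕ) : 2 ^ (s + 44) * (2 * s + 72) * 81 ≤ 3 ^ (s + 36) := by
  induction s with
  | zero => norm_num
  | succ s ih =>
    have : 2 * (2 * (s + 1) + 72) ≤ 3 * (2 * s + 72) := by omega
    calc 2 ^ (s + 1 + 44) * (2 * (s + 1) + 72) * 81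
        = 2 ^ (s + 44) * (2 * (2 * (s + 1) + 72)) * 81 := by ring
      _ ≤ 2 ^ (s + 44) * (3 * (2 * s + 72)) * 81 := by gcongr
      _ = 3 * (2 ^ (s + 44) * (2 * s + 72) * 81) := by ring
      _ ≤ 3 * 3 ^ (s + 36) := by gcongr
      _ = 3 ^ (s + 1 + 36) := by ring

theorem growth_three_pow' (s : ℕ) :
    2 ^ (s + 44) * ((2 * s + 98) * (20 * (901 * (2 * s + 72) ^ 2) + 1)) ≤ 3 ^ (s + 49) := by
  induction s with
  | zero => norm_num
  | succ s ih =>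
    have : 2 * ((2 * (s + 1) + 98) * (20 * (901 * (2 * (s + 1) + 72) ^ 2) + 1)) ≤
      3 * ((2 * s + 98) * (20 * (901 * (2 * s + 72) ^ 2) + 1)) := by nlinarith
    calc 2 ^ (s + 1 + 44) * ((2 * (s + 1) + 98) * (20 * (901 * (2 * (s + 1) + 72) ^ 2) + 1))
        = 2 ^ (s + 44) *
          (2 * ((2 * (s + 1) + 98) * (20 * (901 * (2 * (s + 1) + 72) ^ 2) + 1))) := by
          ring
      _ ≤ 2 ^ (s + 44) * (3 * ((2 * s + 98) * (20 * (901 * (2 * s + 72) ^ 2) + 1))) := by gcongr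
      _ = 3 * (2 ^ (s + 44) * ((2 * s + 98) * (20 * (901 * (2 * s + 72) ^ 2) + 1))) := by ring
      _ ≤ 3 * 3 ^ (s + 49) := by gcongr
      _ = 3 ^ (s + 1 + 49) := by ring

theorem growth_two_pow (s : ℕ) :
    400 * (901 * (2 * s + 72) ^ 2) * (2 * s + 98) * (2 * s + 98) + 6 < 3 * 2 ^ (s + 43) := by
  induction s with
  | zero => norm_num
  | succ s ih =>
    have : 400 * (901 * (2 * (s + 1) + 72) ^ 2) * (2 * (s + 1) + 98) * (2 * (s + 1) + 98) + 6 ≤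
      2 * (400 * (901 * (2 * s + 72) ^ 2) * (2 * s + 98) * (2 * s + 98) + 6) := by nlinarith
    have h2 : 2 ^ (s + 1 + 43) = 2 * 2 ^ (s + 43) := by ring
    omega

theorem exponent_lt_two_pow {n m r x : ℕ} (hm : m ≠ 0) (hmn : m + 4 ≤ n) (hx : 2 ≤ x)
    (h : Nat.fib n ^ x = Nat.fib m ^ x + lucas r) : x < 2 ^ 43 := by
  by_contra! hlarge
  obtain ⟨s, hs1, hs2⟩ : ∃ s, 2 ^ (s + 43) ≤ x ∧ x ≤ 2 ^ (s + 44) := by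
    have h1 : 43 ≤ Nat.log 2 x := Nat.le_log_of_pow_le (by norm_num) hlarge
    obtain ⟨s, hs⟩ := Nat.exists_eq_add_of_le' h1
    exact ⟨s, hs ▸ Nat.pow_log_le_self 2 (by omega),
      (hs ▸ Nat.lt_pow_succ_log_self (by norm_num) x).le⟩
  have hg := growth_two_pow s
  have hsq : 3 * s + 141 ≤ 4 * (2 * s + 72) ^ 2 := by clear * -; nlinarith
  obtain ⟨-, hΛ⟩ := linear_form_bounds hm hmn hx h
  obtain ⟨k, hk, hl, hu⟩ := log_five_form_bounds hm hmn hx h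
  have hφ := goldenRatio_pos
  set E := (φ ^ (2 * n))⁻¹ with hE
  have hE0 : 0 < E := by positivity
  have h5E : (0 : ℝ) < (1 / 5) ^ x := by positivity
  have h5 : (5 : ℝ) ≤ φ ^ 4 := by
    have h5 : 3 / 2 < φ := by
      have : (2 : ℝ) < √5 := by rw [Real.lt_sqrt (by norm_num)]; norm_num
      rw [goldenRatio]; linarith
    have h6 : φ ^ 4 = 3 * φ + 2 := by linear_combination (φ ^ 2 + φ + 2) * goldenRatio_sq
    linarith
  have hT := lt_abs_linear_form (b := 5) (H := 4) (L := 2 * s + 72) (x := x) (r := 2 * k)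
    (by norm_num) le_rfl (by omega) (by exact_mod_cast h5) (by omega) (by omega) (by
      rw [show 2 * s + 72 = (s + 36) * 2 by ring, pow_mul]
      refine Nat.pow_le_pow_left ((?_ : _ ≤ _).trans (growth_three_pow s)) 2
      rw [show (s + 36) * 2 = 2 * s + 72 by ring]
      exact Nat.mul_le_mul_right _ (Nat.mul_le_mul_right _ hs2))
  have habs : |x * log 5 - ((2 * k : ℕ) : ℝ) * log φ| ≤
      4 * x * E + 22 / 5 * (1 / 5) ^ x := abs_le.2 ⟨hl, by linarith⟩
  rw [Nat.cast_ofNat] at hT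
  have hT' := hT.trans_le habs
  have hA : 100 * 4 * (2 * s + 72) * (2 * s + 72) = 400 * (2 * s + 72) ^ 2 := by ring
  have hA4 : 4 * (400 * (2 * s + 72) ^ 2) ≤
      400 * (901 * (2 * s + 72) ^ 2) * (2 * s + 98) * (2 * s + 98) := by
    calc 4 * (400 * (2 * s + 72) ^ 2) = 400 * (4 * (2 * s + 72) ^ 2) * 1 * 1 := by ring
      _ ≤ _ := by gcongr <;> omega
  rw [hA] at hT'
  generalize hAdef : 400 * (2 * s + 72) ^ 2 = A at hT' hA4
  have hn : n ≤ 901 * (2 * s + 72) ^ 2 := by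
    have hE1 : (1 / 8 : ℝ) ^ A < 8 * x * E := by
      by_contra! hcon
      have h1 : (1 / 8 : ℝ) ^ A < 44 / 5 * (1 / 5) ^ x := by linarith
      have := three_mul_lt_of_lt_pow (by norm_num) h1
      omega
    have h2 : φ ^ (2 * n) < 2 ^ (3 * A + s + 47) := by
      rw [hE, ← div_eq_mul_inv, lt_div_iff₀ (by positivity), one_div_pow,
        one_div_mul_eq_div, div_lt_iff₀ (by positivity)] at hE1
      refine hE1.trans_le ?_
      have hx' : (x : ℝ) ≤ 2 ^ (s + 44) := by exact_mod_cast hs2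
      calc 8 * (x : ℝ) * 8 ^ A ≤ 8 * 2 ^ (s + 44) * 8 ^ A := by gcongr
        _ = 2 ^ (3 * A + s + 47) := by
          rw [show (8 : ℝ) = 2 ^ 3 by norm_num, ← pow_mul, ← pow_add, ← pow_add]; ring_nf
    have := two_mul_lt_of_pow_lt h2
    omega
  have hnH : (Nat.fib n : ℝ) ≤ φ ^ (901 * (2 * s + 72) ^ 2) ∧
      r ≤ 901 * (2 * s + 72) ^ 2 * x := by
    obtain ⟨n, rfl⟩ := Nat.exists_eq_add_of_le' (show 1 ≤ n by omega)
    exact ⟨(fib_succ_le_goldenRatio_pow n).trans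
        (pow_le_pow_right₀ one_lt_goldenRatio.le (by omega)),
      (le_mul_of_fib_pow_eq hm h).trans (Nat.mul_le_mul_right _ (by omega))⟩
  have hfib : 2 ≤ Nat.fib n := Nat.fib_mono (show 3 ≤ n by omega)
  have hT2 := lt_abs_linear_form (b := Nat.fib n) (H := 901 * (2 * s + 72) ^ 2)
    (L := 2 * s + 98) (x := x) (r := r) hfib (by omega) (by omega) hnH.1 (by omega) hnH.2 (by
      rw [show (3 : ℕ) ^ (2 * s + 98) = (3 ^ (s + 49)) ^ 2 by rw [← pow_mul]; ring_nf, mul_assoc]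
      exact Nat.pow_le_pow_left ((Nat.mul_le_mul_right _ hs2).trans (growth_three_pow' s)) 2)
  have h0 := (linear_form_bounds hm hmn hx h).1
  rw [abs_of_nonneg h0] at hT2
  have := three_mul_lt_of_lt_pow (by norm_num) (hT2.trans_le hΛ)
  have e : 4 * (100 * (901 * (2 * s + 72) ^ 2) * (2 * s + 98) * (2 * s + 98)) =
      400 * (901 * (2 * s + 72) ^ 2) * (2 * s + 98) * (2 * s + 98) := by ring
  omega

theorem fib_le_goldenRatio_pow_succ (k : ℕ) :
    (3 / 2 * Nat.fib (k + 1) + Nat.fib k : ℝ) ≤ φ ^ (k + 1) := by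
  rw [← goldenRatio_mul_fib_succ_add_fib]
  have h5 : 3 / 2 < φ := by
    have : (2 : ℝ) < √5 := by rw [Real.lt_sqrt (by norm_num)]; norm_num
    rw [goldenRatio]; linarith
  gcongr

theorem inv_goldenRatio_pow_le {k j : ℕ} {c : ℝ} (hc : 0 < c) (hk : k + 1 ≤ j)
    (h : c ≤ 3 / 2 * Nat.fib (k + 1) + Nat.fib k) : (φ ^ j)⁻¹ ≤ c⁻¹ :=
  inv_anti₀ hc ((h.trans (fib_le_goldenRatio_pow_succ k)).trans
    (pow_le_pow_right₀ one_lt_goldenRatio.le hk))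

theorem exponent_lt_of_index_le {n m r x : ℕ} (hm : m ≠ 0) (hmn : m + 4 ≤ n) (hx : 2 ≤ x)
    (hn : n ≤ 75) (h : Nat.fib n ^ x = Nat.fib m ^ x + lucas r) : x < 57000000 := by
  have hx43 := exponent_lt_two_pow hm hmn hx h
  obtain ⟨h0, hΛ⟩ := linear_form_bounds hm hmn hx h
  have hnH : (Nat.fib n : ℝ) ≤ φ ^ 74 ∧ r ≤ 74 * x := by
    obtain ⟨n, rfl⟩ := Nat.exists_eq_add_of_le' (show 1 ≤ n by omega)
    exact ⟨(fib_succ_le_goldenRatio_pow n).trans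
        (pow_le_pow_right₀ one_lt_goldenRatio.le (by omega)),
      (le_mul_of_fib_pow_eq hm h).trans (Nat.mul_le_mul_right _ (by omega))⟩
  have hfib : 2 ≤ Nat.fib n := Nat.fib_mono (show 3 ≤ n by omega)
  have hT := lt_abs_linear_form (b := Nat.fib n) (H := 74) (L := 76) (x := x) (r := r) hfib
    (by norm_num) (by norm_num) hnH.1 (by omega) hnH.2 (by
      rw [show (3 : ℕ) ^ 76 = (3 ^ 38) ^ 2 by norm_num]
      exact Nat.pow_le_pow_left (by omega) 2)
  rw [abs_of_nonneg h0] at hT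
  have := three_mul_lt_of_lt_pow (by norm_num) (hT.trans_le hΛ)
  omega

/-- Consecutive convergents `p / q` and `p' / q'` of `u / l` bound `|x u - r l|` from below for
all positive `x < q + q'`. -/
theorem le_abs_sub_of_convergents {u l g : ℝ} {p q p' q' : ℤ} (hdet : p' * q - p * q' = 1)
    (hg : 0 ≤ g) (hq : 0 ≤ q) (hq' : 0 ≤ q') (h1 : g ≤ q * u - p * l) (h2 : g ≤ p' * l - q' * u)
    {x : ℤ} (hx0 : 0 < x) (hx : x < q + q') (r : ℤ) : g ≤ |x * u - r * l| := by
  obtain ⟨s, hs⟩ : ∃ s, s = p' * x - q' * r := ⟨_, rfl⟩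
  obtain ⟨t, ht⟩ : ∃ t, t = q * r - p * x := ⟨_, rfl⟩
  have hxst : x = q * s + q' * t := by rw [hs, ht]; linear_combination (-x) * hdet
  have hrst : r = p * s + p' * t := by rw [hs, ht]; linear_combination (-r) * hdet
  have key : (x * u - r * l : ℝ) = s * (q * u - p * l) - t * (p' * l - q' * u) := by
    rw [hxst, hrst]; push_cast; ring
  rw [key]
  have hcases : (1 ≤ s ∧ t ≤ 0) ∨ (s ≤ 0 ∧ 1 ≤ t) := by
    by_contra! hcon
    rcases le_or_gt 1 s with hs1 | hs1
    · have := hcon.1 hs1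
      nlinarith
    · have := hcon.2 (by omega)
      nlinarith
  rcases hcases with ⟨h3, h4⟩ | ⟨h3, h4⟩
  · refine le_trans ?_ (le_abs_self _)
    have h3' : (1 : ℝ) ≤ s := by exact_mod_cast h3
    have h4' : (t : ℝ) ≤ 0 := by exact_mod_cast h4
    nlinarith
  · refine le_trans ?_ (neg_le_abs _)
    have h3' : (s : ℝ) ≤ 0 := by exact_mod_cast h3
    have h4' : (1 : ℝ) ≤ t := by exact_mod_cast h4
    nlinarith

/-- The pairs `(p, q)` and `(p', q')` are consecutive convergents of `log 5 / (2 log φ)` of quality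
`g`. -/
def logFiveConvergents (g : ℚ) (p q p' q' : ℕ) : Bool :=
  p' * q == p * q' + 1 && decide (g ≤ q * logFiveLower - p * (2 * logGoldenUpper)) &&
    decide (g ≤ p' * (2 * logGoldenLower) - q' * logFiveUpper)

theorem le_abs_log_five_form {g : ℚ} {p q p' q' : ℕ} (h : logFiveConvergents g p q p' q' = true)
    (hg : 0 ≤ g) {x : ℕ} (hx0 : 0 < x) (hx : x < q + q') (k : ℕ) :
    (g : ℝ) ≤ |x * log 5 - ((2 * k : ℕ) : ℝ) * log φ| := by
  simp only [logFiveConvergents, Bool.and_eq_true, beq_iff_eq, decide_eq_true_eq] at h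
  obtain ⟨⟨hdet, h1⟩, h2⟩ := h
  have h1' := (Rat.cast_le (K := ℝ)).2 h1
  have h2' := (Rat.cast_le (K := ℝ)).2 h2
  push_cast at h1' h2'
  have a1 := mul_le_mul_of_nonneg_left logFiveLower_le (Nat.cast_nonneg (α := ℝ) q)
  have a2 := mul_le_mul_of_nonneg_left le_logFiveUpper (Nat.cast_nonneg (α := ℝ) q')
  have a3 := mul_le_mul_of_nonneg_left le_logGoldenUpper (Nat.cast_nonneg (α := ℝ) p)
  have a4 := mul_le_mul_of_nonneg_left logGoldenLower_le (Nat.cast_nonneg (α := ℝ) p')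
  have := le_abs_sub_of_convergents (u := log 5) (l := 2 * log φ) (g := g) (p := p) (q := q)
    (p' := p') (q' := q') (by have : (p' * q : ℤ) = p * q' + 1 := by exact_mod_cast hdet
                              linarith) (by exact_mod_cast hg) (by positivity) (by positivity)
    (by push_cast; linarith) (by push_cast; linarith) (x := x) (by exact_mod_cast hx0)
    (by exact_mod_cast hx) k
  refine this.trans_eq ?_
  push_cast
  ring_nf

theorem five_inv_pow_le {a x : ℕ} (h : a ≤ x) : (1 / 5 : ℝ) ^ x ≤ (1 / 5) ^ a :=
  pow_le_pow_of_le_one (by norm_num) (by norm_num) h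

theorem exponent_le_sixty_of_index_ge {n m r x : ℕ} (hm : m ≠ 0) (hmn : m + 4 ≤ n) (hx : 2 ≤ x)
    (hn : 42 ≤ n) (h : Nat.fib n ^ x = Nat.fib m ^ x + lucas r) : x ≤ 60 := by
  by_contra! hx61
  obtain ⟨k, -, hl, hu⟩ := log_five_form_bounds hm hmn hx h
  have h5 := five_inv_pow_le (show 61 ≤ x from hx61)
  have h5' : (1 / 5 : ℝ) ^ 61 ≤ 1 / 10 ^ 30 := by norm_num
  have habs : |x * log 5 - ((2 * k : ℕ) : ℝ) * log φ| ≤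
      4 * x * (φ ^ (2 * n))⁻¹ + 22 / 5 * (1 / 5) ^ x := abs_le.2 ⟨hl, by
        have : (0 : ℝ) < (1 / 5) ^ x := by positivity
        linarith⟩
  have hx0 : (0 : ℝ) < x := by exact_mod_cast (by omega : 0 < x)
  rcases le_or_gt n 75 with hn75 | hn75
  · have hx57 := exponent_lt_of_index_le hm hmn hx hn75 h
    have hx57' : (x : ℝ) < 57000000 := by exact_mod_cast hx57
    have hE := inv_goldenRatio_pow_le (k := 83) (j := 2 * n) (c := 33 * 10 ^ 16) (by norm_num)
      (by omega) (by norm_num)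
    have hE' := mul_le_mul_of_nonneg_left hE hx0.le
    have hg := le_abs_log_five_form (g := 1 / 10 ^ 9) (p := 78844287) (q := 47147893)
      (p' := 66989461) (q' := 40058856) (by decide +kernel) (by norm_num) (x := x) (by omega)
      (by omega) k
    have := hg.trans habs
    norm_num at this hE'
    linarith
  · have hx43 := exponent_lt_two_pow hm hmn hx h
    have hx43' : (x : ℝ) < 2 ^ 43 := by exact_mod_cast hx43
    have hE := inv_goldenRatio_pow_le (k := 151) (j := 2 * n) (c := 10 ^ 31) (by norm_num)
      (by omega) (by norm_num)
    have hE' := mul_le_mul_of_nonneg_left hE hx0.le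
    have hg := le_abs_log_five_form (g := 1 / 10 ^ 15) (p := 53635372525772) (q := 32073278877647)
      (p' := 5722968292151) (q' := 3422263133418) (by decide +kernel) (by norm_num) (x := x)
      (by omega) (by omega) k
    have := hg.trans habs
    norm_num at this hE'
    linarith

theorem exponent_gt_sixty_of_index_ge {n m r x : ℕ} (hm : m ≠ 0) (hmn : m + 4 ≤ n) (hx : 2 ≤ x)
    (hn : 12 ≤ n) (h : Nat.fib n ^ x = Nat.fib m ^ x + lucas r) : 60 < x := by
  by_contra! hx60
  obtain ⟨k, -, hl, hu⟩ := log_five_form_bounds hm hmn hx h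
  have hx0 : (0 : ℝ) < x := by exact_mod_cast (by omega : 0 < x)
  have hx60' : (x : ℝ) ≤ 60 := by exact_mod_cast hx60
  have hE := inv_goldenRatio_pow_le (k := 23) (j := 2 * n) (c := 90000) (by norm_num)
    (by omega) (by norm_num)
  have hE' := mul_le_mul_of_nonneg_left hE hx0.le
  have l1 : (0.48121 : ℝ) ≤ log φ := le_trans (by norm_num [logGoldenLower]) logGoldenLower_le
  have l2 : log φ ≤ (0.48122 : ℝ) := le_trans le_logGoldenUpper (by norm_num [logGoldenUpper])
  have l3 : (1.60943 : ℝ) ≤ log 5 := le_trans (by norm_num [logFiveLower]) logFiveLower_le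
  have l4 : log 5 ≤ (1.60944 : ℝ) := le_trans le_logFiveUpper (by norm_num [logFiveUpper])
  push_cast at hl hu
  obtain rfl | rfl | hx4 : x = 2 ∨ x = 3 ∨ 4 ≤ x := by omega
  · norm_num at hl hu hE'
    rcases le_or_gt k 3 with hk | hk
    · have : (k : ℝ) ≤ 3 := by exact_mod_cast hk
      nlinarith
    · have : (4 : ℝ) ≤ k := by exact_mod_cast hk
      nlinarith
  · norm_num at hl hu hE'
    rcases le_or_gt k 5 with hk | hk
    · have : (k : ℝ) ≤ 5 := by exact_mod_cast hk
      nlinarith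
    · have : (6 : ℝ) ≤ k := by exact_mod_cast hk
      nlinarith
  · have := le_abs_log_five_form (g := 76 / 10 ^ 4) (p := 5) (q := 3)
      (p' := 97) (q' := 58) (by decide +kernel) (by norm_num) (x := x)
      (by omega) (by omega) k
    push_cast at this
    rcases hx4.eq_or_lt with rfl | hx5
    · have := this.trans (abs_le.2 ⟨hl, hu.trans (le_add_of_nonneg_right (by positivity))⟩)
      norm_num at this hE'
      linarith
    · have h5 := five_inv_pow_le (show 5 ≤ x from hx5)
      have := this.trans (abs_le.2 ⟨hl, hu.trans (le_add_of_nonneg_right (by positivity))⟩)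
      norm_num at this hE' h5
      linarith

/-- The Taylor polynomial of `log (1 - x)` with `N` terms. -/
def logOneSubTaylor (N : ℕ) (x : ℚ) : ℚ := -∑ i ∈ Finset.range N, x ^ (i + 1) / (i + 1)

theorem abs_log_one_sub_sub_taylor_le {x : ℚ} (h : |x| < 1) (N : ℕ) :
    |log (1 - x) - logOneSubTaylor N x| ≤ ((|x| ^ (N + 1) / (1 - |x|) : ℚ) : ℝ) := by
  have := abs_log_sub_add_sum_range_le (x := (x : ℝ)) (by exact_mod_cast h) N
  push_cast
  refine le_of_eq_of_le ?_ this
  congr 1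
  simp [logOneSubTaylor]
  ring

theorem goldenConj_div_goldenRatio_pow_eq (n : ℕ) :
    (ψ / φ) ^ n = (-1) ^ n * ((lucas (2 * n) - √5 * Nat.fib (2 * n)) / 2) := by
  have h5 : √5 ≠ 0 := by positivity
  have h1 : (lucas (2 * n) - √5 * Nat.fib (2 * n)) / 2 = (ψ ^ 2) ^ n := by
    rw [coe_lucas_eq, coe_fib_eq, mul_div_cancel₀ _ h5, ← pow_mul]
    ring
  rw [h1, ← mul_pow, div_eq_mul_inv, inv_goldenRatio]
  ring

/-- `(ψ / φ) ^ n` with `√5` replaced by `c` if `n` is even and by `d` if `n` is odd. -/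
def goldenQuotient (c d : ℚ) (n : ℕ) : ℚ :=
  if n % 2 = 0 then (lucas (2 * n) - c * Nat.fib (2 * n)) / 2
  else -((lucas (2 * n) - d * Nat.fib (2 * n)) / 2)

theorem goldenQuotient_bounds (n : ℕ) :
    (goldenQuotient sqrtFiveUpper sqrtFiveLower n : ℝ) ≤ (ψ / φ) ^ n ∧
      (ψ / φ) ^ n ≤ goldenQuotient sqrtFiveLower sqrtFiveUpper n := by
  rw [goldenConj_div_goldenRatio_pow_eq]
  have h1 := mul_le_mul_of_nonneg_right sqrtFiveLower_le
    (Nat.cast_nonneg (α := ℝ) (Nat.fib (2 * n)))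
  have h2 := mul_le_mul_of_nonneg_right le_sqrtFiveUpper
    (Nat.cast_nonneg (α := ℝ) (Nat.fib (2 * n)))
  unfold goldenQuotient
  rcases Nat.even_or_odd n with he | ho
  · rw [if_pos (Nat.even_iff.1 he), if_pos (Nat.even_iff.1 he), he.neg_one_pow]
    push_cast
    constructor <;> linarith
  · rw [if_neg (by rw [Nat.odd_iff.1 ho]; norm_num), if_neg (by rw [Nat.odd_iff.1 ho]; norm_num),
      ho.neg_one_pow]
    push_cast
    constructor <;> linarith

/-- A rational lower bound for `log (fib n)`, in terms of an upper bound `e` for `(ψ / φ) ^ n`. -/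
def logFibLower (n : ℕ) (e : ℚ) : ℚ :=
  n * logGoldenLower - logFiveUpper / 2 + (logOneSubTaylor 12 e - |e| ^ 13 / (1 - |e|))

/-- A rational upper bound for `log (fib n)`, in terms of a lower bound `e` for `(ψ / φ) ^ n`. -/
def logFibUpper (n : ℕ) (e : ℚ) : ℚ :=
  n * logGoldenUpper - logFiveLower / 2 + (logOneSubTaylor 12 e + |e| ^ 13 / (1 - |e|))

theorem logFibLower_le {n : ℕ} (hn : 0 < n) {e : ℚ} (he : (ψ / φ) ^ n ≤ e) (h1 : |e| < 1) :
    (logFibLower n e : ℝ) ≤ log (Nat.fib n) := by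
  have h2 := (abs_le.1 (abs_log_one_sub_sub_taylor_le h1 12)).1
  have h3 : (e : ℝ) < 1 := by exact_mod_cast (abs_lt.1 h1).2
  have h4 : log (1 - e) ≤ log (1 - (ψ / φ) ^ n) := Real.log_le_log (by linarith) (by linarith)
  have h5 := mul_le_mul_of_nonneg_left logGoldenLower_le (Nat.cast_nonneg (α := ℝ) n)
  have h6 := le_logFiveUpper
  rw [log_fib_eq hn, logFibLower]
  push_cast at h2 ⊢
  linarith

theorem le_logFibUpper {n : ℕ} (hn : 2 ≤ n) {e : ℚ} (he : (e : ℝ) ≤ (ψ / φ) ^ n) (h1 : |e| < 1) :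
    log (Nat.fib n) ≤ (logFibUpper n e : ℝ) := by
  have h2 := (abs_le.1 (abs_log_one_sub_sub_taylor_le h1 12)).2
  have h3 : (ψ / φ) ^ n < 1 := by
    refine (le_abs_self _).trans_lt ?_
    rw [goldenConj_div_goldenRatio_pow]
    exact inv_lt_one_of_one_lt₀ (one_lt_pow₀ one_lt_goldenRatio (by omega))
  have h4 : log (1 - (ψ / φ) ^ n) ≤ log (1 - e) := Real.log_le_log (by linarith) (by linarith)
  have h5 := mul_le_mul_of_nonneg_left le_logGoldenUpper (Nat.cast_nonneg (α := ℝ) n)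
  have h6 := logFiveLower_le
  rw [log_fib_eq (by omega), logFibUpper]
  push_cast at h2 ⊢
  linarith

/-- The pairs `(p, q)` and `(p', q')` are consecutive convergents of `log (fib n) / log φ` of
quality `10 ^ (-12)`, with `57000000 ≤ q + q'`. -/
def logFibConvergents (n p q p' q' : ℕ) : Bool :=
  let e := goldenQuotient sqrtFiveLower sqrtFiveUpper n
  let e' := goldenQuotient sqrtFiveUpper sqrtFiveLower n
  p' * q == p * q' + 1 && decide (57000000 ≤ q + q') && decide (|e| < 1) && decide (|e'| < 1) &&
    decide (1 / 10 ^ 12 ≤ q * logFibLower n e - p * logGoldenUpper) &&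
    decide (1 / 10 ^ 12 ≤ p' * logGoldenLower - q' * logFibUpper n e')

theorem le_abs_log_fib_form {n p q p' q' : ℕ} (hn : 2 ≤ n)
    (h : logFibConvergents n p q p' q' = true) {x : ℕ} (hx0 : 0 < x) (hx : x < 57000000) (r : ℕ) :
    (1 / 10 ^ 12 : ℝ) ≤ |x * log (Nat.fib n) - r * log φ| := by
  simp only [logFibConvergents, Bool.and_eq_true, beq_iff_eq, decide_eq_true_eq] at h
  obtain ⟨⟨⟨⟨⟨hdet, hle⟩, he⟩, he'⟩, h1⟩, h2⟩ := h
  have h1' := (Rat.cast_le (K := ℝ)).2 h1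
  have h2' := (Rat.cast_le (K := ℝ)).2 h2
  push_cast at h1' h2'
  obtain ⟨b1, b2⟩ := goldenQuotient_bounds n
  have a1 := mul_le_mul_of_nonneg_left (logFibLower_le (by omega) b2 he)
    (Nat.cast_nonneg (α := ℝ) q)
  have a2 := mul_le_mul_of_nonneg_left (le_logFibUpper hn b1 he') (Nat.cast_nonneg (α := ℝ) q')
  have a3 := mul_le_mul_of_nonneg_left le_logGoldenUpper (Nat.cast_nonneg (α := ℝ) p)
  have a4 := mul_le_mul_of_nonneg_left logGoldenLower_le (Nat.cast_nonneg (α := ℝ) p')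
  have := le_abs_sub_of_convergents (u := log (Nat.fib n)) (l := log φ) (g := 1 / 10 ^ 12) (p := p)
    (q := q) (p' := p') (q' := q') (by
      have : (p' * q : ℤ) = p * q' + 1 := by exact_mod_cast hdet
      linarith) (by norm_num) (by positivity) (by positivity)
    (by push_cast; linarith) (by push_cast; linarith) (x := x) (by exact_mod_cast hx0)
    (by exact_mod_cast hx.trans_le hle) r
  simpa using this

/-- Consecutive convergents of `log (fib n) / log φ` for `5 ≤ n ≤ 41`. -/
def logFibConvergentsTable : List (ℕ × ℕ × ℕ × ℕ × ℕ) := [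
  (5, 157688574, 47147893, 66989461, 20029428),
  (6, 27444795, 6351109, 1212332944, 280550781),
  (7, 313097401, 58740408, 103862540, 19485719),
  (8, 293991330, 46467749, 292124189, 46172632),
  (9, 414961635, 56626214, 311743649, 42540951),
  (10, 380160611, 45650754, 215807735, 25914799),
  (11, 176631532, 18936081, 118921314489, 12749159894),
  (12, 4067633771, 393856540, 249912560, 24198269),
  (13, 736318681, 65001423, 123049740, 10862699),
  (14, 624021157, 50619344, 3193928950, 259085107),
  (15, 273210836, 20499435, 626210751, 46985569),
  (16, 787447407, 54959701, 128986249, 9002564),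
  (17, 6137079412, 400390777, 229807573, 14992935),
  (18, 469915897, 28780245, 4043555493, 247649672),
  (19, 919300863, 53053757, 402844841, 23248572),
  (20, 1403778759, 76593185, 562461008, 30689081),
  (21, 107521192, 5563055, 3775792023, 195356267),
  (22, 2034857563, 100102577, 344827294, 16963399),
  (23, 189011260, 8862233, 1547806937, 72572532),
  (24, 1154485249, 51706356, 724832386, 32463335),
  (25, 1207213336, 51750155, 178310451, 7643714),
  (26, 487486525, 20038312, 921121273, 37863027),
  (27, 205372358, 8108599, 2377251645, 93859663),
  (28, 48783882767, 1852947207, 247120048, 9386305),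
  (29, 518696572, 18980599, 2329529019, 85244165),
  (30, 813422693, 28714721, 1039903895, 36709758),
  (31, 422295647, 14399196, 2028996152, 69183553),
  (32, 2406153315, 79338407, 334471913, 11028586),
  (33, 454726144, 14515135, 1441726015, 46020771),
  (34, 1433264711, 44335466, 905793313, 28019087),
  (35, 236261469, 7089037, 2445113005, 73365736),
  (36, 888428343, 25880782, 2020207192, 58850601),
  (37, 1916067297, 54236930, 250439543, 7089037),
  (38, 1455247067, 40058856, 3168022714, 87206749),
  (39, 1759923540, 47147893, 9064235317, 242828502),
  (40, 1535364779, 40058856, 1807071433, 47147893),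
  (41, 1575423635, 40058856, 1854219326, 47147893)]

theorem logFibConvergentsTable_spec :
    (logFibConvergentsTable.all fun (n, p, q, p', q') => logFibConvergents n p q p' q') = true := by
  decide +kernel

theorem exists_logFibConvergents {n : ℕ} (h5 : 5 ≤ n) (h41 : n ≤ 41) :
    ∃ p q p' q', logFibConvergents n p q p' q' = true := by
  have hmem : ∀ n ≤ 41, 5 ≤ n → (logFibConvergentsTable.any fun t => t.1 == n) = true := by
    decide +kernel
  have h1 := hmem n h41 h5
  rw [List.any_eq_true] at h1
  obtain ⟨⟨n', p, q, p', q'⟩, hin, heq⟩ := h1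
  rw [beq_iff_eq] at heq
  subst heq
  exact ⟨p, q, p', q', List.all_eq_true.1 logFibConvergentsTable_spec _ hin⟩

theorem exponent_lt_twenty_of_index_le {n m r x : ℕ} (hm : m ≠ 0) (hmn : m + 4 ≤ n) (hx : 2 ≤ x)
    (hn : n ≤ 41) (h : Nat.fib n ^ x = Nat.fib m ^ x + lucas r) : x < 20 := by
  by_contra! hx20
  obtain ⟨h0, hΛ⟩ := linear_form_bounds hm hmn hx h
  obtain ⟨p, q, p', q', hc⟩ := exists_logFibConvergents (n := n) (by omega) hn
  have h1 := le_abs_log_fib_form (by omega) hc (by omega : 0 < x)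
    (exponent_lt_of_index_le hm hmn hx (by omega) h) r
  rw [abs_of_nonneg h0] at h1
  have h2 := h1.trans (hΛ.trans (mul_le_mul_of_nonneg_left (five_inv_pow_le hx20) (by norm_num)))
  norm_num at h2

end

theorem not_fib_pow_eq_of_small {n m r x : ℕ} (hm : m ≠ 0) (hmn : m + 4 ≤ n) (hn : n ≤ 11)
    (hx : 2 ≤ x) (hx20 : x < 20) : Nat.fib n ^ x ≠ Nat.fib m ^ x + lucas r := by
  intro h
  have hr : r < 200 := by
    obtain ⟨n, rfl⟩ := Nat.exists_eq_add_of_le' (show 1 ≤ n by omega)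
    have := (le_mul_of_fib_pow_eq hm h).trans
      (Nat.mul_le_mul (show n ≤ 10 by omega) (show x ≤ 19 by omega))
    omega
  have key : ((List.range 12).all fun n => (List.range (n - 3)).all fun m => m == 0 ||
      (List.range 18).all fun x => allFibonacciType
        (fun u => Nat.fib n ^ (x + 2) != Nat.fib m ^ (x + 2) + u) 200 2 1) = true := by
    decide +kernel
  simp only [List.all_eq_true, List.mem_range, Bool.or_eq_true, beq_iff_eq] at key
  obtain ⟨x, rfl⟩ := Nat.exists_eq_add_of_le' hx
  have h1 := (key n (by omega) m (by omega)).resolve_left hm x (by omega)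
  exact bne_iff_ne.1 (apply_lucas_of_allFibonacciType h1 hr) h

theorem solutions_of_fib_pow_eq {n m r x : ℕ} (hx : 0 < x)
    (h : Nat.fib n ^ x = Nat.fib m ^ x + lucas r) :
    (n, m, r) = (1, 0, 1) ∨ (n, m, r) = (2, 0, 1) ∨
      (n, m, r, x) ∈ ({(3, 0, 3, 2), (3, 0, 0, 1), (4, 0, 2, 1), (3, 1, 1, 1),
          (3, 2, 1, 1), (3, 1, 2, 2), (3, 2, 2, 2), (3, 1, 4, 3), (3, 2, 4, 3),
          (4, 1, 0, 1), (4, 2, 0, 1), (5, 4, 0, 1), (4, 3, 1, 1), (5, 2, 3, 1),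
          (6, 5, 2, 1), (6, 1, 4, 1), (5, 3, 2, 1)} : Set (ℕ × ℕ × ℕ × ℕ)) ∨
      ∃ k, 4 ≤ k ∧ (n, m, r, x) = (k + 1, k - 3, k - 1, 1) := by
  rcases eq_or_ne m 0 with rfl | hm
  · rw [Nat.fib_zero, zero_pow hx.ne', zero_add] at h
    rcases fib_pow_eq_lucas hx h with ⟨rfl, rfl⟩ | ⟨rfl, rfl⟩ | ⟨rfl, rfl, rfl⟩ | ⟨rfl, rfl, rfl⟩ |
      ⟨rfl, rfl, rfl⟩ <;> simp
  rcases (Nat.succ_le_iff.2 hx).eq_or_lt with rfl | hx2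
  · rw [pow_one, pow_one] at h
    rcases solutions_of_exponent_one hm h with h1 | ⟨k, hk, h1⟩
    · simp only [Set.mem_insert_iff, Set.mem_singleton_iff, Prod.mk.injEq] at h1
      refine .inr (.inr (.inl ?_))
      rcases h1 with h1 | h1 | h1 | h1 | h1 | h1 | h1 | h1 | h1 | h1 <;>
        obtain ⟨rfl, rfl, rfl⟩ := h1 <;> simp
    · exact .inr (.inr (.inr ⟨k, hk, by simpa using h1⟩))
  have hmn : m < n := by
    by_contra! hle
    have := Nat.pow_le_pow_left (Nat.fib_mono hle) x
    have := lucas_pos r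
    omega
  rcases le_or_gt n (m + 3) with hn | hn
  · have h1 := solutions_of_close_indices hx2 hm hmn hn h
    simp only [Set.mem_insert_iff, Set.mem_singleton_iff, Prod.mk.injEq] at h1
    refine .inr (.inr (.inl ?_))
    rcases h1 with h1 | h1 | h1 | h1 <;> obtain ⟨rfl, rfl, rfl, rfl⟩ := h1 <;> simp
  exfalso
  rcases le_or_gt n 41 with h41 | h41
  · have hx20 := exponent_lt_twenty_of_index_le hm hn hx2 h41 h
    rcases le_or_gt n 11 with h11 | h11
    · exact not_fib_pow_eq_of_small hm hn h11 hx2 hx20 h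
    · have := exponent_gt_sixty_of_index_ge hm hn hx2 h11 h
      omega
  · have := exponent_gt_sixty_of_index_ge hm hn hx2 (by omega) h
    have := exponent_le_sixty_of_index_ge hm hn hx2 h41 h
    omega

theorem fib_pow_sub_fib_pow_eq_lucas (n m r x : ℕ) (hx : 0 < x)
    (h : m ≠ 0 → n ≤ 2 * m + 4) :
    (Nat.fib n : ℤ) ^ x - (Nat.fib m : ℤ) ^ x = lucas r ↔
      ((n, m, r) = (1, 0, 1) ∨ (n, m, r) = (2, 0, 1) ∨
        (n, m, r, x) ∈ ({(3, 0, 3, 2), (3, 0, 0, 1), (4, 0, 2, 1), (3, 1, 1, 1),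
            (3, 2, 1, 1), (3, 1, 2, 2), (3, 2, 2, 2), (3, 1, 4, 3), (3, 2, 4, 3),
            (4, 1, 0, 1), (4, 2, 0, 1), (5, 4, 0, 1), (4, 3, 1, 1), (5, 2, 3, 1),
            (6, 5, 2, 1), (6, 1, 4, 1), (5, 3, 2, 1)} : Set (ℕ × ℕ × ℕ × ℕ)) ∨
        ∃ k, 4 ≤ k ∧ (n, m, r, x) = (k + 1, k - 3, k - 1, 1)) := by
  rw [sub_eq_iff_eq_add']
  norm_cast
  refine ⟨solutions_of_fib_pow_eq hx, ?_⟩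
  rintro (h1 | h1 | h1 | ⟨k, hk, h1⟩)
  · obtain ⟨rfl, rfl, rfl⟩ := by simpa using h1
    simp [lucas, hx.ne']
  · obtain ⟨rfl, rfl, rfl⟩ := by simpa using h1
    simp [lucas, hx.ne']
  · simp only [Set.mem_insert_iff, Set.mem_singleton_iff, Prod.mk.injEq] at h1
    rcases h1 with h1 | h1 | h1 | h1 | h1 | h1 | h1 | h1 | h1 | h1 | h1 | h1 | h1 | h1 | h1 | h1 |
      h1 <;> obtain ⟨rfl, rfl, rfl, rfl⟩ := h1 <;> rfl
  · obtain ⟨j, rfl⟩ := Nat.exists_eq_add_of_le' hk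
    simp only [Prod.mk.injEq] at h1
    obtain ⟨rfl, rfl, rfl, rfl⟩ := h1
    have h2 : lucas (j + 3) = Nat.fib (j + 2) + Nat.fib (j + 4) := lucas_succ_eq_fib_add_fib (j + 2)
    have h3 : Nat.fib (j + 5) = Nat.fib (j + 3) + Nat.fib (j + 4) := Nat.fib_add_two
    have h4 : Nat.fib (j + 3) = Nat.fib (j + 1) + Nat.fib (j + 2) := Nat.fib_add_two
    change Nat.fib (j + 5) ^ 1 = Nat.fib (j + 1) ^ 1 + lucas (j + 3)
    rw [pow_one, pow_one]
    omega
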